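/- arXiv:math/0209087 — 5 statements merged into one kernel-verified Lean document; each statement's English description precedes it below -/
import Mathlib

section
/- Let c > 0, set λ = 2c, let (m_n) be a sequence of natural numbers with m_n/n → c, and fix ε > 0 and x_max ∈ ℕ. Then the probability that a uniformly random G : Fin m_n → Fin n × Fin n satisfies |θ_x(G) − p(x,λ)| > ε for at least one x with 0 ≤ x ≤ x_max tends to 0 as n → ∞. -/
open Filter

/-- The Poisson probability `p(x, λ) = e^(−λ) λ^x / x!`. -/
noncomputable def poisson (lam : ℝ) (x : ℕ) : ℝ :=
  Real.exp (-lam) * lam ^ x / (Nat.factorial x)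

/-- The degree of the vertex `v` in the multigraph `G`. -/
def deg {n m : ℕ} (G : Fin m → Fin n × Fin n) (v : Fin n) : ℕ :=
  (Finset.univ.filter fun e => (G e).1 = v).card +
    (Finset.univ.filter fun e => (G e).2 = v).card

/-- `θ_x(G)`: `1/n` times the number of vertices of `G` of degree `x`. -/
noncomputable def theta {n m : ℕ} (G : Fin m → Fin n × Fin n) (x : ℕ) : ℝ :=
  ((Finset.univ.filter fun v => deg G v = x).card : ℝ) / n

open Topology

/-- The number of functions taking the value `v` exactly `x` times. -/
theorem card_filter_card_fiber_eq {ι α : Type*} [Fintype ι] [DecidableEq ι] [Fintype α]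
    [DecidableEq α] (v : α) (x : ℕ) :
    (Finset.univ.filter fun f : ι → α => (Finset.univ.filter fun i => f i = v).card = x).card =
      (Fintype.card ι).choose x * (Fintype.card α - 1) ^ (Fintype.card ι - x) := by
  rw [Finset.card_eq_sum_card_fiberwise (f := fun f : ι → α => Finset.univ.filter fun i => f i = v)
    (t := Finset.powersetCard x Finset.univ)
    (fun f hf => by simpa [Finset.mem_powersetCard] using hf)]
  rw [Finset.sum_congr rfl (g := fun _ => (Fintype.card α - 1) ^ (Fintype.card ι - x)),
    Finset.sum_const, Finset.card_powersetCard, Finset.card_univ, smul_eq_mul]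
  intro A hA
  have hA' : A.card = x := (Finset.mem_powersetCard.1 hA).2
  have key : (Finset.univ.filter fun f : ι → α =>
        (Finset.univ.filter fun i => f i = v).card = x).filter
        (fun f => (Finset.univ.filter fun i => f i = v) = A) =
      Fintype.piFinset fun i => if i ∈ A then {v} else {v}ᶜ := by
    ext f
    simp only [Finset.mem_filter, Finset.mem_univ, true_and, Fintype.mem_piFinset]
    constructor
    · rintro ⟨-, rfl⟩ i
      by_cases h : f i = v <;> simp [h]
    · intro h
      have : (Finset.univ.filter fun i => f i = v) = A := by
        ext i
        have := h i
        by_cases hi : i ∈ A <;> simp_all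
      exact ⟨this ▸ hA', this⟩
  rw [key, Fintype.card_piFinset]
  simp [apply_ite Finset.card, Finset.prod_ite, Finset.card_compl, ← hA', ← Finset.compl_filter]

/-- The number of functions taking each of two distinct values exactly `x` times. -/
theorem card_filter_card_fiber_eq_and {ι α : Type*} [Fintype ι] [DecidableEq ι] [Fintype α]
    [DecidableEq α] {u v : α} (huv : u ≠ v) (x : ℕ) :
    (Finset.univ.filter fun f : ι → α => (Finset.univ.filter fun i => f i = u).card = x ∧
        (Finset.univ.filter fun i => f i = v).card = x).card =
      (Fintype.card ι).choose x * ((Fintype.card ι - x).choose x *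
        (Fintype.card α - 2) ^ (Fintype.card ι - x - x)) := by
  rw [Finset.card_eq_sum_card_fiberwise
    (f := fun f : ι → α => (⟨Finset.univ.filter fun i => f i = u,
      Finset.univ.filter fun i => f i = v⟩ : (_ : Finset ι) × Finset ι))
    (t := (Finset.powersetCard x Finset.univ).sigma fun A => Finset.powersetCard x Aᶜ)
    (fun f hf => by
      have hf' : (Finset.univ.filter fun i => f i = u).card = x ∧
        (Finset.univ.filter fun i => f i = v).card = x := by simpa using hf
      simp only [Finset.coe_sigma, Set.mem_sigma_iff, Finset.mem_coe, Finset.mem_powersetCard,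
        Finset.subset_univ, true_and, hf', and_true]
      intro i hi
      have : f i = v := by simpa using hi
      simp [this, huv.symm])]
  rw [Finset.sum_congr rfl
    (g := fun _ => (Fintype.card α - 2) ^ (Fintype.card ι - x - x)), Finset.sum_const,
    Finset.card_sigma, Finset.sum_congr rfl (g := fun _ => (Fintype.card ι - x).choose x),
    Finset.sum_const, Finset.card_powersetCard, Finset.card_univ, smul_eq_mul, smul_eq_mul,
    mul_assoc]
  · intro A hA
    rw [Finset.card_powersetCard, Finset.card_compl, (Finset.mem_powersetCard.1 hA).2]
  rintro ⟨A, B⟩ hAB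
  obtain ⟨hA, hB⟩ := Finset.mem_sigma.1 hAB
  obtain ⟨-, hA⟩ := Finset.mem_powersetCard.1 hA
  obtain ⟨hAB, hB⟩ := Finset.mem_powersetCard.1 hB
  dsimp only at hA hB hAB
  have hdisj : ∀ i ∈ B, i ∉ A := fun i hi => Finset.mem_compl.1 (hAB hi)
  have key : (Finset.univ.filter fun f : ι → α =>
        (Finset.univ.filter fun i => f i = u).card = x ∧
        (Finset.univ.filter fun i => f i = v).card = x).filter
        (fun f => (⟨Finset.univ.filter fun i => f i = u,
          Finset.univ.filter fun i => f i = v⟩ : (_ : Finset ι) × Finset ι) = ⟨A, B⟩) =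
      Fintype.piFinset fun i => if i ∈ A then {u} else if i ∈ B then {v} else {u, v}ᶜ := by
    ext f
    simp only [Finset.mem_filter, Finset.mem_univ, true_and, Fintype.mem_piFinset,
      Sigma.mk.injEq, heq_eq_eq]
    constructor
    · rintro ⟨-, rfl, rfl⟩ i
      by_cases h : f i = u <;> by_cases h' : f i = v <;> simp [h, h', huv.symm]
    · intro h
      have h1 : (Finset.univ.filter fun i => f i = u) = A := by
        ext i
        have := h i
        have := huv.symm
        by_cases hi : i ∈ A <;> by_cases hi' : i ∈ B <;> simp_all
      have h2 : (Finset.univ.filter fun i => f i = v) = B := by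
        ext i
        have := h i
        have := hdisj i
        by_cases hi : i ∈ A <;> by_cases hi' : i ∈ B <;> simp_all
      exact ⟨⟨h1 ▸ hA, h2 ▸ hB⟩, h1, h2⟩
  have hcard (i : ι) : (if i ∈ A then ({u} : Finset α) else
      if i ∈ B then {v} else {u, v}ᶜ).card =
      if i ∈ A ∪ B then 1 else Fintype.card α - 2 := by
    have hc : ({u, v}ᶜ : Finset α).card = Fintype.card α - 2 := by
      rw [Finset.card_compl, Finset.card_pair huv]
    by_cases hi : i ∈ A <;> by_cases hi' : i ∈ B <;> simp [hi, hi', hc, -Finset.compl_insert]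
  have hU : (A ∪ B).card = x + x := by
    rw [Finset.card_union_of_disjoint (Finset.disjoint_right.2 hdisj), hA, hB]
  rw [key, Fintype.card_piFinset, Finset.prod_congr rfl fun i _ => hcard i, Finset.prod_ite,
    Finset.prod_const_one, one_mul, Finset.prod_const, ← Finset.compl_filter,
    Finset.filter_mem_eq_inter, Finset.univ_inter, Finset.card_compl, hU, Nat.sub_sub]

/-- The Poisson limit theorem, with the number of trials and the success probability `1 / q`
both depending on the index. -/
theorem tendsto_choose_mul_pow_div_pow {N q : ℕ → ℕ} {r : ℝ} (hr : 0 < r)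
    (hq : Tendsto q atTop atTop) (hN : Tendsto (fun n => (N n : ℝ) / q n) atTop (𝓝 r)) (x : ℕ) :
    Tendsto (fun n => ((N n).choose x : ℝ) * ((q n - 1 : ℕ) : ℝ) ^ (N n - x) / (q n : ℝ) ^ N n)
      atTop (𝓝 (poisson r x)) := by
  have hq' : Tendsto (fun n => (q n : ℝ)) atTop atTop := tendsto_natCast_atTop_atTop.comp hq
  have hp : Tendsto (fun n => (q n : ℝ)⁻¹) atTop (𝓝 0) := tendsto_inv_atTop_zero.comp hq'
  have hNtop : Tendsto N atTop atTop := by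
    rw [← tendsto_natCast_atTop_iff (R := ℝ)]
    refine (hN.pos_mul_atTop hr hq').congr' ?_
    filter_upwards [hq.eventually_ge_atTop 1] with n hn
    have : (q n : ℝ) ≠ 0 := by positivity
    field_simp
  have hlog : Tendsto (fun n => (N n : ℝ) * Real.log (1 - (q n : ℝ)⁻¹)) atTop (𝓝 (-r)) := by
    have hlow : Tendsto (fun n => -((N n : ℝ) / q n) * (1 - (q n : ℝ)⁻¹)⁻¹) atTop (𝓝 (-r)) := by
      simpa using hN.neg.mul ((hp.const_sub 1).inv₀ (by simp))
    refine tendsto_of_tendsto_of_tendsto_of_le_of_le' hlow hN.neg ?_ ?_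
    · filter_upwards [hq.eventually_ge_atTop 2] with n hn
      have h2 : (2 : ℝ) ≤ q n := by exact_mod_cast hn
      have hpos : 0 < 1 - (q n : ℝ)⁻¹ := by
        have := inv_lt_one_of_one_lt₀ (by linarith : (1 : ℝ) < q n)
        linarith
      have h := mul_le_mul_of_nonneg_left (Real.one_sub_inv_le_log_of_pos hpos)
        (Nat.cast_nonneg (N n))
      refine le_of_eq_of_le ?_ h
      have h1 : (q n : ℝ) ≠ 0 := by positivity
      have h1' : (q n : ℝ) - 1 ≠ 0 := by linarith
      have : 1 - (q n : ℝ)⁻¹ = (q n - 1) / q n := by field_simp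
      rw [this]
      field_simp
      ring
    · filter_upwards [hq.eventually_ge_atTop 2] with n hn
      have h2 : (2 : ℝ) ≤ q n := by exact_mod_cast hn
      have hpos : 0 < 1 - (q n : ℝ)⁻¹ := by
        have := inv_lt_one_of_one_lt₀ (by linarith : (1 : ℝ) < q n)
        linarith
      have h := mul_le_mul_of_nonneg_left (Real.log_le_sub_one_of_pos hpos)
        (Nat.cast_nonneg (N n))
      refine h.trans_eq ?_
      rw [div_eq_mul_inv]
      ring
  have hexp := (Real.continuous_exp.tendsto _).comp hlog
  have hchoose : Tendsto (fun n => ((N n).choose x : ℝ) * ((q n : ℝ)⁻¹) ^ x) atTop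
      (𝓝 (r ^ x / x.factorial)) := by
    have h := ((isEquivalent_choose x).comp_tendsto hNtop).mul
      (Asymptotics.IsEquivalent.refl (u := fun n => ((q n : ℝ)⁻¹) ^ x))
    refine h.symm.tendsto_nhds ((hN.pow x).div_const _ |>.congr fun n => ?_)
    simp only [Function.comp, Pi.mul_apply]
    rw [div_pow, inv_pow]
    ring
  have hone : Tendsto (fun n => ((1 - (q n : ℝ)⁻¹) ^ x)⁻¹) atTop (𝓝 1) := by
    simpa using ((hp.const_sub 1).pow x).inv₀ (by simp)
  have hlim := (hchoose.mul hexp).mul hone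
  have hval : r ^ x / x.factorial * Real.exp (-r) * 1 = poisson r x := by
    rw [poisson]; ring
  rw [hval] at hlim
  refine hlim.congr' ?_
  filter_upwards [hq.eventually_ge_atTop 2, hNtop.eventually_ge_atTop x] with n hn hx
  have h2 : (2 : ℝ) ≤ q n := by exact_mod_cast hn
  have h1 : (q n : ℝ) ≠ 0 := by positivity
  have h1' : (q n : ℝ) - 1 ≠ 0 := by linarith
  have hpos : 0 < 1 - (q n : ℝ)⁻¹ := by
    have := inv_lt_one_of_one_lt₀ (by linarith : (1 : ℝ) < q n)
    linarith
  have he : Real.exp ((N n : ℝ) * Real.log (1 - (q n : ℝ)⁻¹)) = (1 - (q n : ℝ)⁻¹) ^ N n := by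
    rw [Real.exp_nat_mul, Real.exp_log hpos]
  have hsub : 1 - (q n : ℝ)⁻¹ = (q n - 1) / q n := by field_simp
  obtain ⟨k, hk⟩ := Nat.exists_eq_add_of_le hx
  simp only [Function.comp, he]
  rw [hsub]
  rw [hk, Nat.add_sub_cancel_left, Nat.cast_sub (by omega), Nat.cast_one, div_pow, div_pow,
    inv_pow, pow_add, pow_add]
  field_simp

/-- The second moment of the proportion of vertices of degree `x` about `p`, as a sum over all
multigraphs. -/
theorem sum_sq_theta_sub {n m : ℕ} (hn : 2 ≤ n) (x : ℕ) (p : ℝ) :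
    (∑ G : Fin m → Fin n × Fin n, (theta G x - p) ^ 2) =
      ((2 * m).choose x * ((n - 1 : ℕ) : ℝ) ^ (2 * m - x)) / n +
      (1 - 1 / (n : ℝ)) * ((2 * m).choose x *
        (((2 * m - x).choose x : ℝ) * ((n - 2 : ℕ) : ℝ) ^ (2 * m - x - x))) -
      2 * p * ((2 * m).choose x * ((n - 1 : ℕ) : ℝ) ^ (2 * m - x)) +
      p ^ 2 * (n : ℝ) ^ (2 * m) := by
  let e : (Fin m → Fin n × Fin n) ≃ (Fin m ⊕ Fin m → Fin n) :=
    (Equiv.arrowProdEquivProdArrow _ _ _).trans (Equiv.sumArrowEquivProdArrow _ _ _).symm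
  have hdeg (G : Fin m → Fin n × Fin n) (v : Fin n) :
      deg G v = (Finset.univ.filter fun i => e G i = v).card := by
    rw [Finset.card_filter, Fintype.sum_sum_type, deg, Finset.card_filter, Finset.card_filter]
    rfl
  have hN : Fintype.card (Fin m ⊕ Fin m) = 2 * m := by simp [two_mul]
  have h1 (v : Fin n) : (Finset.univ.filter fun G : Fin m → Fin n × Fin n => deg G v = x).card =
      (2 * m).choose x * (n - 1) ^ (2 * m - x) := by
    have h := card_filter_card_fiber_eq (ι := Fin m ⊕ Fin m) v x
    rw [hN, Fintype.card_fin] at h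
    rw [← h]
    exact Finset.card_equiv e fun G => by simp [hdeg]
  have h2 {u v : Fin n} (huv : u ≠ v) :
      (Finset.univ.filter fun G : Fin m → Fin n × Fin n => deg G u = x ∧ deg G v = x).card =
      (2 * m).choose x * ((2 * m - x).choose x * (n - 2) ^ (2 * m - x - x)) := by
    have h := card_filter_card_fiber_eq_and (ι := Fin m ⊕ Fin m) huv x
    rw [hN, Fintype.card_fin] at h
    rw [← h]
    exact Finset.card_equiv e fun G => by simp [hdeg]
  set C1 : ℕ := (2 * m).choose x * (n - 1) ^ (2 * m - x) with hC1
  set C2 : ℕ := (2 * m).choose x * ((2 * m - x).choose x * (n - 2) ^ (2 * m - x - x)) with hC2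
  have hS1 : ∑ G : Fin m → Fin n × Fin n,
      ((Finset.univ.filter fun v => deg G v = x).card : ℝ) = n * C1 := by
    simp_rw [Finset.card_filter, Nat.cast_sum]
    rw [Finset.sum_comm]
    simp_rw [← Nat.cast_sum, ← Finset.card_filter, h1]
    simp
  have hrow (u : Fin n) : ∑ v : Fin n, ((Finset.univ.filter fun G : Fin m → Fin n × Fin n =>
      deg G u = x ∧ deg G v = x).card : ℝ) = C1 + (n - 1) * C2 := by
    rw [← Finset.add_sum_erase _ _ (Finset.mem_univ u),
      Finset.sum_congr rfl (g := fun _ => (C2 : ℝ))]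
    · simp [h1, Nat.cast_sub (by omega : 1 ≤ n)]
    · intro v hv
      rw [h2 (Finset.ne_of_mem_erase hv).symm]
  have hS2 : ∑ G : Fin m → Fin n × Fin n,
      ((Finset.univ.filter fun v => deg G v = x).card : ℝ) ^ 2 = n * (C1 + (n - 1) * C2) := by
    have hsq (G : Fin m → Fin n × Fin n) :
        ((Finset.univ.filter fun v => deg G v = x).card : ℝ) ^ 2 =
        ∑ u : Fin n, ∑ v : Fin n, ((if deg G u = x ∧ deg G v = x then 1 else 0 : ℕ) : ℝ) := by
      rw [sq, Finset.card_filter, Nat.cast_sum, Finset.sum_mul_sum]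
      refine Finset.sum_congr rfl fun u _ => Finset.sum_congr rfl fun v _ => ?_
      by_cases hu : deg G u = x <;> by_cases hv : deg G v = x <;> simp [hu, hv]
    simp_rw [hsq]
    rw [Finset.sum_comm]
    have hu (u : Fin n) : ∑ G : Fin m → Fin n × Fin n, ∑ v : Fin n,
        ((if deg G u = x ∧ deg G v = x then 1 else 0 : ℕ) : ℝ) = C1 + (n - 1) * C2 := by
      rw [Finset.sum_comm, ← hrow u]
      refine Finset.sum_congr rfl fun v _ => ?_
      rw [Finset.card_filter, Nat.cast_sum]
    rw [Finset.sum_congr rfl fun u _ => hu u, Finset.sum_const, Finset.card_univ, Fintype.card_fin,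
      nsmul_eq_mul]
  have hcard : ((Fintype.card (Fin m → Fin n × Fin n) : ℕ) : ℝ) = (n : ℝ) ^ (2 * m) := by
    simp [pow_mul, sq]
  have hn0 : (n : ℝ) ≠ 0 := by positivity
  have hexpand (G : Fin m → Fin n × Fin n) : (theta G x - p) ^ 2 =
      ((Finset.univ.filter fun v => deg G v = x).card : ℝ) ^ 2 * (1 / (n : ℝ) ^ 2) -
      ((Finset.univ.filter fun v => deg G v = x).card : ℝ) * (2 * p / n) + p ^ 2 := by
    rw [theta]
    ring
  simp_rw [hexpand]
  rw [Finset.sum_add_distrib, Finset.sum_sub_distrib, ← Finset.sum_mul, ← Finset.sum_mul, hS1, hS2,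
    Finset.sum_const, Finset.card_univ, nsmul_eq_mul, hcard]
  have hc1 : ((2 * m).choose x : ℝ) * ((n - 1 : ℕ) : ℝ) ^ (2 * m - x) = C1 := by
    rw [hC1]; push_cast; rfl
  have hc2 : ((2 * m).choose x : ℝ) * (((2 * m - x).choose x : ℝ) *
      ((n - 2 : ℕ) : ℝ) ^ (2 * m - x - x)) = C2 := by
    rw [hC2]; push_cast; rfl
  rw [hc1, hc2]
  field_simp

/-- The proportion of vertices of degree `x` converges to the Poisson probability in mean
square. -/
theorem tendsto_sum_sq_theta_sub_poisson {c : ℝ} (hc : 0 < c) {m : ℕ → ℕ}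
    (hm : Tendsto (fun n => (m n : ℝ) / n) atTop (𝓝 c)) (x : ℕ) :
    Tendsto (fun n => (∑ G : Fin (m n) → Fin n × Fin n, (theta G x - poisson (2 * c) x) ^ 2) /
      (n : ℝ) ^ (2 * m n)) atTop (𝓝 0) := by
  set p := poisson (2 * c) x
  have hN : Tendsto (fun n => ((2 * m n : ℕ) : ℝ) / (n : ℕ)) atTop (𝓝 (2 * c)) :=
    (hm.const_mul 2).congr fun n => by push_cast; ring
  have hinv : Tendsto (fun n : ℕ => 1 / (n : ℝ)) atTop (𝓝 0) := tendsto_one_div_atTop_nhds_zero_nat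
  have hNtop : ∀ᶠ n in atTop, x ≤ 2 * m n := by
    have h : Tendsto (fun n => 2 * m n) atTop atTop := by
      rw [← tendsto_natCast_atTop_iff (R := ℝ)]
      refine (hN.pos_mul_atTop (by positivity) tendsto_natCast_atTop_atTop).congr' ?_
      filter_upwards [eventually_ge_atTop 1] with n hn
      have : (n : ℝ) ≠ 0 := by positivity
      field_simp
    exact h.eventually_ge_atTop x
  have hN' : Tendsto (fun n => ((2 * m n - x : ℕ) : ℝ) / (n - 1 : ℕ)) atTop (𝓝 (2 * c)) := by
    have h := (hN.sub (hinv.const_mul (x : ℝ))).mul ((hinv.const_sub 1).inv₀ (by simp))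
    simp only [mul_zero, sub_zero, inv_one, mul_one] at h
    refine h.congr' ?_
    filter_upwards [eventually_ge_atTop 2, hNtop] with n hn hx
    have h2 : (2 : ℝ) ≤ n := by exact_mod_cast hn
    have h1 : (n : ℝ) ≠ 0 := by positivity
    have h1' : (n : ℝ) - 1 ≠ 0 := by linarith
    have hsub : 1 - 1 / (n : ℝ) = (n - 1) / n := by field_simp
    rw [hsub, Nat.cast_sub hx, Nat.cast_sub (by omega : 1 ≤ n), Nat.cast_one]
    field_simp
  have hP1 := tendsto_choose_mul_pow_div_pow (by positivity : 0 < 2 * c) tendsto_id hN x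
  have hP2 := tendsto_choose_mul_pow_div_pow (by positivity : 0 < 2 * c)
    (tendsto_sub_atTop_nat 1) hN' x
  have hlim := (((hP1.mul hinv).add ((hinv.const_sub 1).mul (hP1.mul hP2))).sub
    (hP1.const_mul (2 * p))).add_const (p ^ 2)
  have hval : p * 0 + (1 - 0) * (p * p) - 2 * p * p + p ^ 2 = 0 := by ring
  rw [hval] at hlim
  refine hlim.congr' ?_
  filter_upwards [eventually_ge_atTop 2, hNtop] with n hn hx
  have h2 : (2 : ℝ) ≤ n := by exact_mod_cast hn
  have h1 : (n : ℝ) ≠ 0 := by positivity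
  have h1' : ((n - 1 : ℕ) : ℝ) ≠ 0 := by
    have : n - 1 ≠ 0 := by omega
    exact_mod_cast this
  rw [sum_sq_theta_sub hn]
  simp only [id, Nat.sub_sub n 1 1, Nat.reduceAdd]
  field_simp

/-- Chebyshev's inequality for the uniform distribution on a finite type. -/
theorem card_filter_lt_abs_mul_sq_le {Ω : Type*} [Fintype Ω] (f : Ω → ℝ) {ε : ℝ} (hε : 0 < ε) :
    ((Finset.univ.filter fun ω => ε < |f ω|).card : ℝ) ≤ (∑ ω, f ω ^ 2) / ε ^ 2 := by
  rw [le_div_iff₀ (by positivity), ← nsmul_eq_mul]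
  refine (Finset.card_nsmul_le_sum _ (fun ω => f ω ^ 2) _ fun ω hω => ?_).trans
    (Finset.sum_le_univ_sum_of_nonneg fun ω => sq_nonneg _)
  rw [← sq_abs (f ω)]
  exact pow_le_pow_left₀ hε.le (Finset.mem_filter.1 hω).2.le 2

/-- Let `c > 0`, `λ = 2c`, `m_n / n → c`, and fix `ε > 0` and `x_max`. The probability
that a uniformly random `G : Fin (m n) → Fin n × Fin n` satisfies `|θ_x(G) − p(x,λ)| > ε`
for at least one `x ≤ x_max` tends to `0`. -/
theorem stmt6 (c : ℝ) (hc : 0 < c) (m : ℕ → ℕ)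
    (hm : Tendsto (fun n => (m n : ℝ) / n) atTop (nhds c))
    (ε : ℝ) (hε : 0 < ε) (xmax : ℕ) :
    Tendsto (fun n =>
      (Nat.card {G : Fin (m n) → Fin n × Fin n //
          ∃ x ≤ xmax, ε < |theta G x - poisson (2 * c) x|} : ℝ) /
        (n : ℝ) ^ (2 * m n))
      atTop (nhds 0) := by
  have hlim : Tendsto (fun n => ∑ x ∈ Finset.range (xmax + 1),
      (∑ G : Fin (m n) → Fin n × Fin n, (theta G x - poisson (2 * c) x) ^ 2) /
        (n : ℝ) ^ (2 * m n) / ε ^ 2) atTop (nhds 0) := by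
    simpa using tendsto_finsetSum (Finset.range (xmax + 1)) fun x _ =>
      (tendsto_sum_sq_theta_sub_poisson hc hm x).div_const (ε ^ 2)
  refine squeeze_zero (fun n => by positivity) (fun n => ?_) hlim
  classical
  have hunion : Nat.card {G : Fin (m n) → Fin n × Fin n //
      ∃ x ≤ xmax, ε < |theta G x - poisson (2 * c) x|} ≤
      ∑ x ∈ Finset.range (xmax + 1), (Finset.univ.filter fun G : Fin (m n) → Fin n × Fin n =>
        ε < |theta G x - poisson (2 * c) x|).card := by
    rw [Nat.card_eq_fintype_card, Fintype.card_subtype]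
    refine (Finset.card_le_card fun G hG => ?_).trans Finset.card_biUnion_le
    simpa [Nat.lt_succ_iff] using hG
  calc _ ≤ (∑ x ∈ Finset.range (xmax + 1),
        (∑ G : Fin (m n) → Fin n × Fin n, (theta G x - poisson (2 * c) x) ^ 2) / ε ^ 2) /
        (n : ℝ) ^ (2 * m n) := by
        refine div_le_div_of_nonneg_right ?_ (by positivity)
        refine (Nat.cast_le.2 hunion).trans ?_
        rw [Nat.cast_sum]
        exact Finset.sum_le_sum fun x _ => card_filter_lt_abs_mul_sq_le _ hε
    _ = _ := by
        rw [Finset.sum_div]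
        exact Finset.sum_congr rfl fun x _ => div_right_comm _ _ _
end

section
/- For all n, m ∈ ℕ and every G : Fin m → Fin n × Fin n, if G admits a proper 3-colouring then G admits a rigid proper 3-colouring; in particular, R(G) ≥ 1 for every 3-colourable G. -/
/-- A proper 3-colouring of the multigraph `G`. -/
def Proper {n m : ℕ} (G : Fin m → Fin n × Fin n) (σ : Fin n → Fin 3) : Prop :=
  ∀ e, σ (G e).1 ≠ σ (G e).2

/-- `v` and `w` are joined by an edge of `G`. -/
def Adj {n m : ℕ} (G : Fin m → Fin n × Fin n) (v w : Fin n) : Prop :=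
  ∃ e, G e = (v, w) ∨ G e = (w, v)

/-- A colouring is rigid if every vertex of colour 0 is joined to at least one vertex of
colour 1 and at least one of colour 2, and every vertex of colour 1 is joined to at least
one vertex of colour 2. -/
def Rigid {n m : ℕ} (G : Fin m → Fin n × Fin n) (σ : Fin n → Fin 3) : Prop :=
  (∀ v, σ v = 0 → (∃ w, Adj G v w ∧ σ w = 1) ∧ (∃ w, Adj G v w ∧ σ w = 2)) ∧
    (∀ v, σ v = 1 → ∃ w, Adj G v w ∧ σ w = 2)

/-- `R(G)`: the number of rigid proper 3-colourings of `G`. -/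
noncomputable def R {n m : ℕ} (G : Fin m → Fin n × Fin n) : ℕ :=
  Nat.card {σ : Fin n → Fin 3 // Proper G σ ∧ Rigid G σ}

/-- Recolouring a vertex with a colour absent from its neighbourhood keeps a colouring proper. -/
theorem Proper.update {n m : ℕ} {G : Fin m → Fin n × Fin n} {σ : Fin n → Fin 3}
    (hσ : Proper G σ) {v : Fin n} {c : Fin 3} (hc : ∀ w, Adj G v w → σ w ≠ c) :
    Proper G (Function.update σ v c) := by
  intro e
  have he := hσ e
  by_cases h₁ : (G e).1 = v <;> by_cases h₂ : (G e).2 = v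
  · exact absurd (by rw [h₁, h₂]) he
  · rw [h₁, Function.update_self, Function.update_of_ne h₂]
    exact (hc _ ⟨e, Or.inl (by rw [← h₁])⟩).symm
  · rw [h₂, Function.update_self, Function.update_of_ne h₁]
    exact hc _ ⟨e, Or.inr (by rw [← h₂])⟩
  · rwa [Function.update_of_ne h₁, Function.update_of_ne h₂]

/-- In a proper colouring with maximal colour sum, every vertex is joined to a vertex of each
larger colour. -/
theorem exists_adj_of_maximal_sum {n m : ℕ} {G : Fin m → Fin n × Fin n} {σ : Fin n → Fin 3}
    (hσ : Proper G σ)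
    (hmax : ∀ τ : Fin n → Fin 3, Proper G τ → ∑ v, (τ v : ℕ) ≤ ∑ v, (σ v : ℕ))
    {v : Fin n} {c : Fin 3} (hvc : σ v < c) : ∃ w, Adj G v w ∧ σ w = c := by
  by_contra! hc
  refine (hmax _ (hσ.update hc)).not_gt (Finset.sum_lt_sum (fun w _ => ?_)
    ⟨v, Finset.mem_univ v, by simpa using hvc⟩)
  rcases eq_or_ne w v with rfl | hw
  · simpa using hvc.le
  · simp [hw]

/-- If `G` admits a proper 3-colouring then it admits a rigid proper 3-colouring;
in particular `R(G) ≥ 1`. -/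
theorem stmt7 (n m : ℕ) (G : Fin m → Fin n × Fin n)
    (h : ∃ σ : Fin n → Fin 3, Proper G σ) :
    (∃ σ : Fin n → Fin 3, Proper G σ ∧ Rigid G σ) ∧ 1 ≤ R G := by
  classical
  have hrigid : ∃ σ : Fin n → Fin 3, Proper G σ ∧ Rigid G σ := by
    obtain ⟨σ, hσ, hmax⟩ := Set.exists_max_image {σ : Fin n → Fin 3 | Proper G σ}
      (fun σ => ∑ v, (σ v : ℕ)) (Set.toFinite _) h
    refine ⟨σ, hσ, fun v hv => ⟨?_, ?_⟩, fun v hv => ?_⟩ <;>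
      exact exists_adj_of_maximal_sum hσ hmax (by rw [hv]; decide)
  obtain ⟨σ, hσ⟩ := hrigid
  have : Nonempty {σ : Fin n → Fin 3 // Proper G σ ∧ Rigid G σ} := ⟨⟨σ, hσ⟩⟩
  exact ⟨⟨σ, hσ⟩, Nat.card_pos⟩
end

section
/- Let 2.4 < c < 2.5 and λ = 2c. There exists X_0 ∈ ℕ such that for every X ≥ X_0, setting U(X) = λ^(−1)·Σ_{x=0}^{X} x·p_x, the system of equations λ·φ0 = Σ_{x=0}^{X} x·p_x·A0(x,φ)/B(x,φ) and λ·φ1 = Σ_{x=0}^{X} x·p_x·A1(x,φ)/B(x,φ), where φ2 = U(X) − φ0 − φ1, has exactly one solution (φ0, φ1) with 0.26 < φ0 < 0.4, 0.26 < φ1 < 0.4 and 0.26 < φ2 < 0.4. -/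
/-- `A0(x, φ) = max(0, 2^x − 2) (1 − 2φ0)^x`. -/
noncomputable def A0 (phi0 : ℝ) (x : ℕ) : ℝ := max 0 ((2 : ℝ) ^ x - 2) * (1 - 2 * phi0) ^ x

/-- `A1(x, φ) = (2^x − 1) (1 − 2φ1)^x`. -/
noncomputable def A1 (phi1 : ℝ) (x : ℕ) : ℝ := ((2 : ℝ) ^ x - 1) * (1 - 2 * phi1) ^ x

/-- `A2(x, φ) = 2^x (1 − 2φ2)^x`. -/
noncomputable def A2 (phi2 : ℝ) (x : ℕ) : ℝ := (2 : ℝ) ^ x * (1 - 2 * phi2) ^ x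

/-- `B(x, φ) = A0(x, φ) + A1(x, φ) + A2(x, φ)`. -/
noncomputable def B (phi0 phi1 phi2 : ℝ) (x : ℕ) : ℝ :=
  A0 phi0 x + A1 phi1 x + A2 phi2 x

/-- `U(X) = λ⁻¹ Σ_{x=0}^{X} x p_x`. -/
noncomputable def Upart (lam : ℝ) (X : ℕ) : ℝ :=
  lam⁻¹ * ∑ x ∈ Finset.range (X + 1), (x : ℝ) * poisson lam x

section GibbsSystem

variable {ι : Type*} [Fintype ι]

/-- The share of index `k` in the total of the terms `a j x * u j ^ x`. -/
noncomputable def gibbsShare (a : ι → ℕ → ℝ) (u : ι → ℝ) (k : ι) (x : ℕ) : ℝ :=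
  a k x * u k ^ x / ∑ j, a j x * u j ^ x

theorem gibbsTotal_pos {a : ι → ℕ → ℝ} (ha : ∀ k x, 0 ≤ a k x) (ha' : ∀ x, ∃ k, 0 < a k x)
    {u : ι → ℝ} (hu : ∀ k, 0 < u k) (x : ℕ) : 0 < ∑ j, a j x * u j ^ x := by
  obtain ⟨k, hk⟩ := ha' x
  exact Finset.sum_pos' (fun j _ => mul_nonneg (ha j x) (pow_pos (hu j) x).le)
    ⟨k, Finset.mem_univ k, mul_pos hk (pow_pos (hu k) x)⟩

theorem gibbsShare_le_gibbsShare {a : ι → ℕ → ℝ} (ha : ∀ k x, 0 ≤ a k x)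
    (ha' : ∀ x, ∃ k, 0 < a k x) {u v : ι → ℝ} (hu : ∀ k, 0 < u k) (hv : ∀ k, 0 < v k) {k : ι}
    (h : ∀ j, u j * v k ≤ u k * v j) (x : ℕ) : gibbsShare a v k x ≤ gibbsShare a u k x := by
  unfold gibbsShare
  rw [div_le_div_iff₀ (gibbsTotal_pos ha ha' hv x) (gibbsTotal_pos ha ha' hu x),
    Finset.mul_sum, Finset.mul_sum]
  refine Finset.sum_le_sum fun j _ => ?_
  have hj := pow_le_pow_left₀ (mul_pos (hu j) (hv k)).le (h j) x
  rw [mul_pow, mul_pow] at hj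
  have := mul_le_mul_of_nonneg_left hj (mul_nonneg (ha k x) (ha j x))
  linarith

theorem sum_gibbsShare {a : ι → ℕ → ℝ} (ha : ∀ k x, 0 ≤ a k x) (ha' : ∀ x, ∃ k, 0 < a k x)
    {u : ι → ℝ} (hu : ∀ k, 0 < u k) (x : ℕ) : ∑ k, gibbsShare a u k x = 1 := by
  unfold gibbsShare
  rw [← Finset.sum_div, div_self (gibbsTotal_pos ha ha' hu x).ne']

theorem gibbsShare_const (a : ι → ℕ → ℝ) {r : ℝ} (hr : 0 < r) (k : ι) (x : ℕ) :
    gibbsShare a (fun _ => r) k x = a k x / ∑ j, a j x := by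
  unfold gibbsShare
  rw [← Finset.sum_mul, mul_div_mul_right _ _ (pow_pos hr x).ne']

theorem gibbsSystem_le {a : ι → ℕ → ℝ} (ha : ∀ k x, 0 ≤ a k x) (ha' : ∀ x, ∃ k, 0 < a k x)
    {w : ℕ → ℝ} (hw : ∀ x, 0 ≤ w x) (s : Finset ℕ) {κ : ℝ} (hκ : 0 < κ) {u v : ι → ℝ}
    (hu : ∀ k, 0 < u k) (hv : ∀ k, 0 < v k)
    (hus : ∀ k, ∑ x ∈ s, w x * gibbsShare a u k x = κ * (1 - u k))
    (hvs : ∀ k, ∑ x ∈ s, w x * gibbsShare a v k x = κ * (1 - v k)) (i : ι) : u i ≤ v i := by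
  obtain ⟨k, -, hk⟩ := Finset.exists_max_image Finset.univ (fun j => u j / v j) ⟨i, Finset.mem_univ i⟩
  have hk' : ∀ j, u j / v j ≤ u k / v k := fun j => hk j (Finset.mem_univ j)
  have hle : κ * (1 - v k) ≤ κ * (1 - u k) := by
    rw [← hus, ← hvs]
    refine Finset.sum_le_sum fun x _ => mul_le_mul_of_nonneg_left ?_ (hw x)
    exact gibbsShare_le_gibbsShare ha ha' hu hv
      (fun j => (div_le_div_iff₀ (hv j) (hv k)).1 (hk' j)) x
  have huv : u k ≤ v k := by linarith [le_of_mul_le_mul_left hle hκ]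
  exact (div_le_one (hv i)).1 ((hk' i).trans ((div_le_one (hv k)).2 huv))

theorem deriv_eq_zero_of_isMinOn_Icc {f : ℝ → ℝ} {f' l h t : ℝ} (ht : t ∈ Set.Icc l h)
    (hlh : l < h) (hf : HasDerivAt f f' t) (hmin : ∀ y ∈ Set.Icc l h, f t ≤ f y)
    (hl : t = l → f' < 0) (hh : t = h → 0 < f') : (l < t ∧ t < h) ∧ f' = 0 := by
  have hlo : IsLocalMinOn f (Set.Icc l h) t :=
    (isMinOn_iff.2 hmin).localize
  have key : ∀ y ∈ Set.Icc l h, 0 ≤ f' * (y - t) := by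
    intro y hy
    have := hlo.hasFDerivWithinAt_nonneg hf.hasFDerivAt.hasFDerivWithinAt
      (sub_mem_posTangentConeAt_of_segment_subset ((convex_Icc l h).segment_subset ht hy))
    simpa [mul_comm] using this
  have hlt : l < t := by
    refine lt_of_le_of_ne ht.1 fun e => ?_
    nlinarith [hl e.symm, key h ⟨hlh.le, le_rfl⟩]
  have hth : t < h := by
    refine lt_of_le_of_ne ht.2 fun e => ?_
    nlinarith [hh e, key l ⟨le_rfl, hlh.le⟩]
  refine ⟨⟨hlt, hth⟩, le_antisymm ?_ ?_⟩
  · nlinarith [key l ⟨le_rfl, hlh.le⟩]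
  · nlinarith [key h ⟨hlh.le, le_rfl⟩]

/-- The convex potential (in the coordinates `log u`) whose critical points solve the system. -/
noncomputable def gibbsPotential (a : ι → ℕ → ℝ) (p : ℕ → ℝ) (s : Finset ℕ) (κ : ℝ)
    (u : ι → ℝ) : ℝ :=
  ∑ x ∈ s, p x * Real.log (∑ j, a j x * u j ^ x) - κ * ∑ j, (Real.log (u j) - u j)

theorem hasDerivAt_gibbsPotential_update [DecidableEq ι] {a : ι → ℕ → ℝ}
    (ha : ∀ k x, 0 ≤ a k x) (ha' : ∀ x, ∃ k, 0 < a k x) (p : ℕ → ℝ) (s : Finset ℕ) (κ : ℝ)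
    {u : ι → ℝ} (hu : ∀ k, 0 < u k) (k : ι) :
    HasDerivAt (fun t => gibbsPotential a p s κ (Function.update u k t))
      ((∑ x ∈ s, (x * p x) * gibbsShare a u k x - κ * (1 - u k)) / u k) (u k) := by
  have hupd : ∀ j, HasDerivAt (fun t => Function.update u k t j) (if j = k then 1 else 0) (u k) := by
    intro j
    by_cases hj : j = k
    · subst hj
      simpa using hasDerivAt_id' (u j)
    · simpa [hj] using hasDerivAt_const (u k) (u j)
  have hT : ∀ x, HasDerivAt (fun t => ∑ j, a j x * Function.update u k t j ^ x)
      (a k x * (x * u k ^ (x - 1))) (u k) := by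
    intro x
    have := HasDerivAt.fun_sum (u := Finset.univ)
      fun j _ => ((hupd j).fun_pow x).const_mul (a j x)
    simpa using this
  have hL : ∀ x, HasDerivAt (fun t => p x * Real.log (∑ j, a j x * Function.update u k t j ^ x))
      (p x * (a k x * (x * u k ^ (x - 1)) / ∑ j, a j x * u j ^ x)) (u k) := by
    intro x
    have := ((hT x).log (by simpa using (gibbsTotal_pos ha ha' hu x).ne')).const_mul (p x)
    simpa using this
  have hR : HasDerivAt (fun t => ∑ j, (Real.log (Function.update u k t j)
      - Function.update u k t j)) (1 / u k - 1) (u k) := by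
    have := HasDerivAt.fun_sum (u := Finset.univ)
      fun j _ => ((hupd j).log (by simpa using (hu j).ne')).sub (hupd j)
    simpa [Finset.sum_sub_distrib, ite_div] using this
  have := (HasDerivAt.fun_sum (u := s) fun x _ => hL x).sub (hR.const_mul κ)
  refine this.congr_deriv ?_
  have hk := (hu k).ne'
  rw [sub_div, Finset.sum_div]
  congr 1
  · refine Finset.sum_congr rfl fun x _ => ?_
    unfold gibbsShare
    have := (gibbsTotal_pos ha ha' hu x).ne'
    rcases x with _ | x
    · simp
    · field_simp
      simp [pow_succ, mul_assoc]
  · field_simp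

theorem exists_gibbsSystem_solution {a : ι → ℕ → ℝ} (ha : ∀ k x, 0 ≤ a k x)
    (ha' : ∀ x, ∃ k, 0 < a k x) {p : ℕ → ℝ} (hp : ∀ x, 0 ≤ p x) (s : Finset ℕ) (κ : ℝ)
    {l h : ℝ} (hl : 0 < l) (hlh : l < h)
    (hsl : ∀ k, ∑ x ∈ s, (x * p x) * (a k x / ∑ j, a j x) < κ * (1 - l))
    (hsh : ∀ k, κ * (1 - h) < ∑ x ∈ s, (x * p x) * (a k x / ∑ j, a j x)) :
    ∃ u : ι → ℝ, (∀ k, l < u k ∧ u k < h) ∧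
      ∀ k, ∑ x ∈ s, (x * p x) * gibbsShare a u k x = κ * (1 - u k) := by
  classical
  have hpos : ∀ u ∈ Set.Icc (fun _ : ι => l) (fun _ => h), ∀ k, 0 < u k :=
    fun u hu k => hl.trans_le (hu.1 k)
  have hcont : ContinuousOn (gibbsPotential a p s κ) (Set.Icc (fun _ : ι => l) (fun _ => h)) := by
    unfold gibbsPotential
    refine ContinuousOn.sub (continuousOn_finsetSum _ fun x _ => continuousOn_const.mul
      (ContinuousOn.log (by fun_prop) fun u hu => (gibbsTotal_pos ha ha' (hpos u hu) x).ne'))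
      (continuousOn_const.mul (continuousOn_finsetSum _ fun j _ => ContinuousOn.sub
        (ContinuousOn.log (by fun_prop) fun u hu => (hpos u hu j).ne') (by fun_prop)))
  obtain ⟨u, hu, hmin⟩ := isCompact_Icc.exists_isMinOn
    (⟨fun _ => l, le_rfl, fun _ => hlh.le⟩ : (Set.Icc (fun _ : ι => l) (fun _ => h)).Nonempty) hcont
  have hup := hpos u hu
  have hw : ∀ x : ℕ, 0 ≤ x * p x := fun x => mul_nonneg x.cast_nonneg (hp x)
  have key : ∀ k, (l < u k ∧ u k < h) ∧
      (∑ x ∈ s, (x * p x) * gibbsShare a u k x - κ * (1 - u k)) / u k = 0 := by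
    intro k
    refine deriv_eq_zero_of_isMinOn_Icc ⟨hu.1 k, hu.2 k⟩ hlh
      (hasDerivAt_gibbsPotential_update ha ha' p s κ hup k) ?_ ?_ ?_
    · intro y hy
      rw [Function.update_eq_self]
      refine hmin ⟨fun j => ?_, fun j => ?_⟩
      · by_cases hj : j = k
        · subst hj; simpa using hy.1
        · simpa [hj] using hu.1 j
      · by_cases hj : j = k
        · subst hj; simpa using hy.2
        · simpa [hj] using hu.2 j
    · intro e
      refine div_neg_of_neg_of_pos (sub_neg.2 ?_) (hup k)
      rw [e]
      refine lt_of_le_of_lt (Finset.sum_le_sum fun x _ => mul_le_mul_of_nonneg_left ?_ (hw x)) (hsl k)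
      rw [← gibbsShare_const a hl]
      refine gibbsShare_le_gibbsShare ha ha' (fun _ => hl) hup (fun j => ?_) x
      rw [e]
      exact mul_le_mul_of_nonneg_left (hu.1 j) hl.le
    · intro e
      refine div_pos (sub_pos.2 ?_) (hup k)
      rw [e]
      refine (hsh k).trans_le (Finset.sum_le_sum fun x _ => mul_le_mul_of_nonneg_left ?_ (hw x))
      rw [← gibbsShare_const a (hl.trans hlh)]
      refine gibbsShare_le_gibbsShare ha ha' hup (fun _ => hl.trans hlh) (fun j => ?_) x
      rw [e, mul_comm]
      exact mul_le_mul_of_nonneg_left (hu.2 j) (hl.trans hlh).le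
  refine ⟨u, fun k => (key k).1, fun k => ?_⟩
  have := (div_eq_zero_iff.1 (key k).2).resolve_right (hup k).ne'
  linarith

end GibbsSystem

theorem poisson_nonneg {lam : ℝ} (h : 0 ≤ lam) (x : ℕ) : 0 ≤ poisson lam x := by
  unfold poisson
  positivity

theorem succ_mul_poisson (lam : ℝ) (x : ℕ) :
    ((x + 1 : ℕ) : ℝ) * poisson lam (x + 1) = lam * poisson lam x := by
  unfold poisson
  rw [Nat.factorial_succ, pow_succ']
  push_cast
  field_simp

theorem Upart_eq {lam : ℝ} (h : lam ≠ 0) (X : ℕ) :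
    Upart lam X = ∑ x ∈ Finset.range X, poisson lam x := by
  unfold Upart
  rw [Finset.sum_range_succ']
  simp only [succ_mul_poisson, ← Finset.mul_sum]
  simp [h]

theorem sum_poisson_mul_pow_le {lam r : ℝ} (h : 0 ≤ lam) (hr : 0 ≤ r) (X : ℕ) :
    ∑ x ∈ Finset.range X, poisson lam x * r ^ x ≤ Real.exp (-lam) * Real.exp (lam * r) := by
  have := mul_le_mul_of_nonneg_left (Real.sum_le_exp_of_nonneg (mul_nonneg h hr) X)
    (Real.exp_pos (-lam)).le
  refine le_trans (le_of_eq ?_) this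
  rw [Finset.mul_sum]
  refine Finset.sum_congr rfl fun x _ => ?_
  unfold poisson
  rw [mul_pow]
  ring

theorem tendsto_Upart {lam : ℝ} (h : lam ≠ 0) :
    Filter.Tendsto (Upart lam) Filter.atTop (nhds 1) := by
  have h1 : HasSum (fun x : ℕ => lam ^ x / (x.factorial : ℝ)) (Real.exp lam) := by
    rw [Real.exp_eq_exp_ℝ]
    exact NormedSpace.expSeries_div_hasSum_exp lam
  have h2 := (h1.mul_left (Real.exp (-lam))).tendsto_sum_nat
  rw [← Real.exp_add, neg_add_cancel, Real.exp_zero] at h2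
  refine h2.congr fun X => ?_
  rw [Upart_eq h]
  refine Finset.sum_congr rfl fun x _ => ?_
  unfold poisson
  ring

/-- The coefficients of `A0`, `A1`, `A2`. -/
noncomputable def coeffA : Fin 3 → ℕ → ℝ :=
  ![fun x => max 0 ((2 : ℝ) ^ x - 2), fun x => (2 : ℝ) ^ x - 1, fun x => (2 : ℝ) ^ x]

theorem coeffA_nonneg (k : Fin 3) (x : ℕ) : 0 ≤ coeffA k x := by
  have : (1 : ℝ) ≤ 2 ^ x := one_le_pow₀ (by norm_num)
  fin_cases k <;> simp [coeffA, this]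

theorem exists_coeffA_pos (x : ℕ) : ∃ k, 0 < coeffA k x :=
  ⟨2, by simp [coeffA]⟩

theorem abs_coeffA_div_sub_le (k : Fin 3) (x : ℕ) :
    |coeffA k (x + 1) / ∑ j, coeffA j (x + 1) - 1 / 3| ≤ (1 / 3) * (1 / 2) ^ x := by
  have h1 : (1 : ℝ) ≤ 2 ^ x := one_le_pow₀ (by norm_num)
  have hmax : max 0 ((2 : ℝ) ^ (x + 1) - 2) = 2 ^ (x + 1) - 2 :=
    max_eq_right (by rw [pow_succ]; linarith)
  rw [one_div_pow, abs_le]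
  generalize hy : (2 : ℝ) ^ x = y at *
  obtain ⟨d, rfl⟩ : ∃ d, y = (d + 1) / 2 := ⟨2 * y - 1, by ring⟩
  have hpow : (2 : ℝ) ^ (x + 1) = d + 1 := by rw [pow_succ, hy]; ring
  rw [hpow] at hmax
  have hd : 0 < d := by linarith
  have hs : ∑ j, coeffA j (x + 1) = 3 * d := by
    simp only [Fin.sum_univ_three, coeffA, Matrix.cons_val, hpow, hmax]
    ring
  have hb : 1 / (3 * d) ≤ 1 / 3 * (1 / ((d + 1) / 2)) := by
    rw [← one_div_mul_one_div]
    exact mul_le_mul_of_nonneg_left (one_div_le_one_div_of_le (by linarith) (by linarith)) (by norm_num)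
  have hb0 : 0 < 1 / (3 * d) := by positivity
  rw [hs]
  fin_cases k <;>
    simp only [coeffA, Fin.zero_eta, Fin.mk_one, Fin.reduceFinMk, Matrix.cons_val, hpow, hmax]
  · have : (d + 1 - 2) / (3 * d) - 1 / 3 = -(1 / (3 * d)) := by field_simp; ring
    rw [this]
    constructor <;> linarith
  · have : (d + 1 - 1) / (3 * d) - 1 / 3 = 0 := by field_simp; ring
    rw [this]
    constructor <;> linarith
  · have : (d + 1) / (3 * d) - 1 / 3 = 1 / (3 * d) := by field_simp; ring
    rw [this]
    constructor <;> linarith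

theorem abs_sum_coeffA_sub_le {lam : ℝ} (h : 0 < lam) (k : Fin 3) (X : ℕ) :
    |∑ x ∈ Finset.range (X + 1), (x * poisson lam x) * (coeffA k x / ∑ j, coeffA j x)
      - lam * Upart lam X / 3| ≤ lam / 3 * Real.exp (-(lam / 2)) := by
  have hE := sum_poisson_mul_pow_le h.le (by norm_num : (0 : ℝ) ≤ 1 / 2) X
  rw [← Real.exp_add, show -lam + lam * (1 / 2) = -(lam / 2) by ring] at hE
  have hrw : ∑ x ∈ Finset.range (X + 1), (x * poisson lam x) * (coeffA k x / ∑ j, coeffA j x)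
      - lam * Upart lam X / 3 = ∑ x ∈ Finset.range X, lam * poisson lam x *
        (coeffA k (x + 1) / ∑ j, coeffA j (x + 1) - 1 / 3) := by
    rw [Finset.sum_range_succ', Upart_eq h.ne']
    simp only [succ_mul_poisson, mul_sub, Finset.sum_sub_distrib, Nat.cast_zero, zero_mul, add_zero,
      ← Finset.sum_mul, ← Finset.mul_sum]
    ring
  rw [hrw]
  refine (Finset.abs_sum_le_sum_abs _ _).trans ?_
  calc _ ≤ ∑ x ∈ Finset.range X, lam / 3 * (poisson lam x * (1 / 2) ^ x) := by
        refine Finset.sum_le_sum fun x _ => ?_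
        have hp := mul_nonneg h.le (poisson_nonneg h.le x)
        rw [abs_mul, abs_of_nonneg hp]
        have := mul_le_mul_of_nonneg_left (abs_coeffA_div_sub_le k x) hp
        linarith
    _ ≤ _ := by
        rw [← Finset.mul_sum]
        exact mul_le_mul_of_nonneg_left hE (by positivity)

theorem B_eq_sum_coeffA (u : Fin 3 → ℝ) (x : ℕ) :
    B ((1 - u 0) / 2) ((1 - u 1) / 2) ((1 - u 2) / 2) x = ∑ j, coeffA j x * u j ^ x := by
  simp [B, A0, A1, A2, coeffA, Fin.sum_univ_three, mul_div_cancel₀]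

theorem system_iff_gibbsSystem {lam : ℝ} (h : 0 < lam) (X : ℕ) {u : Fin 3 → ℝ}
    (hu : ∀ k, 0 < u k) :
    (Upart lam X - (1 - u 0) / 2 - (1 - u 1) / 2 = (1 - u 2) / 2 ∧
      lam * ((1 - u 0) / 2) = ∑ x ∈ Finset.range (X + 1), (x : ℝ) * poisson lam x *
        A0 ((1 - u 0) / 2) x / B ((1 - u 0) / 2) ((1 - u 1) / 2) ((1 - u 2) / 2) x ∧
      lam * ((1 - u 1) / 2) = ∑ x ∈ Finset.range (X + 1), (x : ℝ) * poisson lam x *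
        A1 ((1 - u 1) / 2) x / B ((1 - u 0) / 2) ((1 - u 1) / 2) ((1 - u 2) / 2) x) ↔
    ∀ k, ∑ x ∈ Finset.range (X + 1), (x * poisson lam x) * gibbsShare coeffA u k x
      = lam / 2 * (1 - u k) := by
  have e0 : ∀ x : ℕ, (x : ℝ) * poisson lam x * A0 ((1 - u 0) / 2) x /
      B ((1 - u 0) / 2) ((1 - u 1) / 2) ((1 - u 2) / 2) x
      = (x * poisson lam x) * gibbsShare coeffA u 0 x := by
    intro x
    rw [B_eq_sum_coeffA, mul_div_assoc]
    simp [gibbsShare, A0, coeffA, mul_div_cancel₀]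
  have e1 : ∀ x : ℕ, (x : ℝ) * poisson lam x * A1 ((1 - u 1) / 2) x /
      B ((1 - u 0) / 2) ((1 - u 1) / 2) ((1 - u 2) / 2) x
      = (x * poisson lam x) * gibbsShare coeffA u 1 x := by
    intro x
    rw [B_eq_sum_coeffA, mul_div_assoc]
    simp [gibbsShare, A1, coeffA, mul_div_cancel₀]
  have hsum : ∑ k, ∑ x ∈ Finset.range (X + 1), (x * poisson lam x) * gibbsShare coeffA u k x
      = lam * Upart lam X := by
    rw [Finset.sum_comm]
    simp only [← Finset.mul_sum, sum_gibbsShare coeffA_nonneg exists_coeffA_pos hu, mul_one]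
    rw [Upart, mul_inv_cancel_left₀ h.ne']
  rw [Fin.sum_univ_three] at hsum
  simp only [e0, e1, Fin.forall_fin_succ, Fin.succ_zero_eq_one, Fin.succ_one_eq_two,
    IsEmpty.forall_iff, and_true]
  constructor
  · rintro ⟨h2, h0, h1⟩
    refine ⟨by linarith, by linarith, ?_⟩
    have := congrArg (lam * ·) h2
    simp only [mul_sub] at this
    linarith
  · rintro ⟨h0, h1, h2⟩
    refine ⟨mul_left_cancel₀ h.ne' ?_, by linarith, by linarith⟩
    simp only [mul_sub]
    linarith

/-- For `2.4 < c < 2.5` and `λ = 2c`, there is `X₀` such that for every `X ≥ X₀`, the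
truncated system `λφ0 = Σ_{x≤X} x p_x A0(x,φ)/B(x,φ)`, `λφ1 = Σ_{x≤X} x p_x A1(x,φ)/B(x,φ)`
with `φ2 = U(X) − φ0 − φ1` has exactly one solution with `0.26 < φ0, φ1, φ2 < 0.4`. -/
theorem stmt9 (c : ℝ) (hc1 : 2.4 < c) (hc2 : c < 2.5) :
    ∃ X0 : ℕ, ∀ X ≥ X0,
      ∃! phi : ℝ × ℝ,
        (0.26 < phi.1 ∧ phi.1 < 0.4) ∧ (0.26 < phi.2 ∧ phi.2 < 0.4) ∧
        (0.26 < Upart (2 * c) X - phi.1 - phi.2 ∧ Upart (2 * c) X - phi.1 - phi.2 < 0.4) ∧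
        (2 * c) * phi.1 = ∑ x ∈ Finset.range (X + 1), (x : ℝ) * poisson (2 * c) x *
            A0 phi.1 x / B phi.1 phi.2 (Upart (2 * c) X - phi.1 - phi.2) x ∧
        (2 * c) * phi.2 = ∑ x ∈ Finset.range (X + 1), (x : ℝ) * poisson (2 * c) x *
            A1 phi.2 x / B phi.1 phi.2 (Upart (2 * c) X - phi.1 - phi.2) x := by
  have hlam : 0 < 2 * c := by linarith
  obtain ⟨X0, hX0⟩ := Filter.eventually_atTop.1
    ((tendsto_Upart hlam.ne').eventually (lt_mem_nhds (by norm_num : (0.98 : ℝ) < 1)))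
  refine ⟨X0, fun X hX => ?_⟩
  have hU := hX0 X hX
  have hU1 : Upart (2 * c) X ≤ 1 := by
    have := sum_poisson_mul_pow_le hlam.le zero_le_one X
    rw [← Real.exp_add, mul_one, neg_add_cancel, Real.exp_zero] at this
    simpa [Upart_eq hlam.ne'] using this
  have hexp : Real.exp (-(2 * c / 2)) < 0.2 := by
    rw [mul_div_cancel_left₀ c two_ne_zero, Real.exp_neg, inv_lt_comm₀ (Real.exp_pos c) (by norm_num)]
    have := Real.quadratic_le_exp_of_nonneg (x := c) (by linarith)
    norm_num
    nlinarith
  have hbound := fun k => abs_le.1 (abs_sum_coeffA_sub_le hlam k X)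
  have hmul := mul_lt_mul_of_pos_left hexp hlam
  obtain ⟨u, hu, hsys⟩ := exists_gibbsSystem_solution coeffA_nonneg exists_coeffA_pos
    (poisson_nonneg hlam.le) (Finset.range (X + 1)) (2 * c / 2) (l := 0.2) (h := 0.48)
    (by norm_num) (by norm_num)
    (fun k => by nlinarith [hbound k])
    (fun k => by nlinarith [hbound k])
  have hup : ∀ k, 0 < u k := fun k => lt_trans (by norm_num) (hu k).1
  obtain ⟨h2, h0, h1⟩ := (system_iff_gibbsSystem hlam X hup).2 hsys
  have hrange : ∀ k, 0.26 < (1 - u k) / 2 ∧ (1 - u k) / 2 < 0.4 := fun k =>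
    ⟨by linarith [(hu k).2], by linarith [(hu k).1]⟩
  refine ⟨((1 - u 0) / 2, (1 - u 1) / 2), ⟨hrange 0, hrange 1, ?_⟩, ?_⟩
  · simp only [h2]
    exact ⟨hrange 2, h0, h1⟩
  · rintro ⟨f, g⟩ ⟨hf, hg, hfg, hf', hg'⟩
    dsimp only at hf hg hfg hf' hg'
    let v : Fin 3 → ℝ := ![1 - 2 * f, 1 - 2 * g, 1 - 2 * (Upart (2 * c) X - f - g)]
    have hv : ∀ k, 0 < v k := by
      intro k
      fin_cases k
      · change 0 < 1 - 2 * f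
        linarith
      · change 0 < 1 - 2 * g
        linarith
      · change 0 < 1 - 2 * (Upart (2 * c) X - f - g)
        linarith
    have v0 : (1 - v 0) / 2 = f := by simp [v]
    have v1 : (1 - v 1) / 2 = g := by simp [v]
    have v2 : (1 - v 2) / 2 = Upart (2 * c) X - f - g := by simp [v]
    have hvs := (system_iff_gibbsSystem hlam X hv).1 (by rw [v0, v1, v2]; exact ⟨rfl, hf', hg'⟩)
    have hw : ∀ x : ℕ, 0 ≤ (x : ℝ) * poisson (2 * c) x := fun x =>
      mul_nonneg x.cast_nonneg (poisson_nonneg hlam.le x)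
    have huv : v = u := funext fun k => le_antisymm
      (gibbsSystem_le coeffA_nonneg exists_coeffA_pos hw _ (half_pos hlam) hv hup hvs hsys k)
      (gibbsSystem_le coeffA_nonneg exists_coeffA_pos hw _ (half_pos hlam) hup hv hsys hvs k)
    rw [← huv, v0, v1]
end

section
/- Let 2.4 < c < 2.5 and λ = 2c. The system of equations λ·φ0 = Σ_{x=0}^{∞} x·p_x·A0(x,φ)/B(x,φ) and λ·φ1 = Σ_{x=0}^{∞} x·p_x·A1(x,φ)/B(x,φ), where φ2 = 1 − φ0 − φ1, has exactly one solution (φ0, φ1) with 0.26 < φ0 < 0.4, 0.26 < φ1 < 0.4 and 0.26 < φ2 < 0.4. -/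
theorem hasSum_mul_poisson_mul_pow (lam r : ℝ) :
    HasSum (fun x : ℕ => (x : ℝ) * poisson lam x * r ^ x)
      (lam * r * Real.exp (lam * r - lam)) := by
  have h := (NormedSpace.expSeries_div_hasSum_exp (lam * r)).mul_left
    (lam * r * Real.exp (-lam))
  rw [← Real.exp_eq_exp_ℝ] at h
  rw [← hasSum_nat_add_iff' 1]
  have e : lam * r * Real.exp (lam * r - lam) =
      lam * r * Real.exp (-lam) * Real.exp (lam * r) := by
    rw [mul_assoc _ (Real.exp _), ← Real.exp_add]; ring_nf
  simp only [Finset.range_one, Finset.sum_singleton, Nat.cast_zero, zero_mul, sub_zero, e]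
  refine h.congr_fun fun x => ?_
  have := Nat.cast_ne_zero (R := ℝ).2 (Nat.factorial_ne_zero x)
  have h1 : (x : ℝ) + 1 ≠ 0 := by positivity
  simp only [poisson, Nat.factorial_succ]
  push_cast
  field_simp
  ring

/-- The coefficients `max(0, 2^x − 2)`, `2^x − 1`, `2^x`. -/
def coef (i : Fin 3) (x : ℕ) : ℝ := ![max 0 ((2 : ℝ) ^ x - 2), (2 : ℝ) ^ x - 1, (2 : ℝ) ^ x] i

/-- The common denominator, in the coordinates `q i = 1 − 2φᵢ`. -/
def denom (q : Fin 3 → ℝ) (x : ℕ) : ℝ := ∑ i, coef i x * q i ^ x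

/-- The quotient `Aᵢ/B`, in the coordinates `q i = 1 − 2φᵢ`. -/
noncomputable def share (q : Fin 3 → ℝ) (i : Fin 3) (x : ℕ) : ℝ := coef i x * q i ^ x / denom q x

/-- The series `∑ x·p_x·Aᵢ/B`, in the coordinates `q i = 1 − 2φᵢ`. -/
noncomputable def mean (lam : ℝ) (q : Fin 3 → ℝ) (i : Fin 3) : ℝ :=
  ∑' x : ℕ, x * poisson lam x * share q i x

theorem coef_nonneg (i : Fin 3) (x : ℕ) : 0 ≤ coef i x := by
  have : (1 : ℝ) ≤ 2 ^ x := one_le_pow₀ (by norm_num)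
  fin_cases i <;> simp [coef, this]

theorem coef_le (i : Fin 3) (x : ℕ) : coef i x ≤ 2 ^ x := by
  fin_cases i <;> simp [coef]

theorem coef_mul_pow_le_denom {q : Fin 3 → ℝ} (hq : ∀ i, 0 < q i) (i : Fin 3) (x : ℕ) :
    coef i x * q i ^ x ≤ denom q x :=
  Finset.single_le_sum (f := fun i => coef i x * q i ^ x)
    (fun j _ => mul_nonneg (coef_nonneg j x) (pow_nonneg (hq j).le x)) (Finset.mem_univ i)

theorem pow_le_denom {q : Fin 3 → ℝ} (hq : ∀ i, 0 < q i) (x : ℕ) :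
    (2 * q 2) ^ x ≤ denom q x := by
  simpa [coef, mul_pow] using coef_mul_pow_le_denom hq 2 x

theorem denom_pos {q : Fin 3 → ℝ} (hq : ∀ i, 0 < q i) (x : ℕ) : 0 < denom q x :=
  (pow_pos (mul_pos two_pos (hq 2)) x).trans_le (pow_le_denom hq x)

theorem share_nonneg {q : Fin 3 → ℝ} (hq : ∀ i, 0 < q i) (i : Fin 3) (x : ℕ) :
    0 ≤ share q i x :=
  div_nonneg (mul_nonneg (coef_nonneg i x) (pow_nonneg (hq i).le x)) (denom_pos hq x).le

theorem share_le_one {q : Fin 3 → ℝ} (hq : ∀ i, 0 < q i) (i : Fin 3) (x : ℕ) :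
    share q i x ≤ 1 :=
  (div_le_one (denom_pos hq x)).2 (coef_mul_pow_le_denom hq i x)

theorem sum_share {q : Fin 3 → ℝ} (hq : ∀ i, 0 < q i) (x : ℕ) : ∑ i, share q i x = 1 := by
  simp only [share, ← Finset.sum_div]
  exact div_self (denom_pos hq x).ne'

theorem hasSum_mul_poisson (lam : ℝ) :
    HasSum (fun x : ℕ => (x : ℝ) * poisson lam x) lam := by
  simpa using hasSum_mul_poisson_mul_pow lam 1

theorem hasSum_mean {lam : ℝ} (hl : 0 ≤ lam) {q : Fin 3 → ℝ} (hq : ∀ i, 0 < q i) (i : Fin 3) :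
    HasSum (fun x : ℕ => x * poisson lam x * share q i x) (mean lam q i) := by
  refine (Summable.of_nonneg_of_le (fun x => ?_) (fun x => ?_)
    (hasSum_mul_poisson lam).summable).hasSum
  · exact mul_nonneg (mul_nonneg x.cast_nonneg (poisson_nonneg hl x)) (share_nonneg hq i x)
  · exact mul_le_of_le_one_right (mul_nonneg x.cast_nonneg (poisson_nonneg hl x))
      (share_le_one hq i x)

theorem sum_mean {lam : ℝ} (hl : 0 ≤ lam) {q : Fin 3 → ℝ} (hq : ∀ i, 0 < q i) :
    ∑ i, mean lam q i = lam := by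
  refine (hasSum_sum fun i _ => hasSum_mean hl hq i).unique ?_
  simpa only [← Finset.mul_sum, sum_share hq, mul_one] using hasSum_mul_poisson lam

theorem pow_sub_pow_mul_log_sub_log_nonneg {a b : ℝ} (ha : 0 < a) (hb : 0 < b) (x : ℕ) :
    0 ≤ (a ^ x - b ^ x) * (Real.log a - Real.log b) := by
  rcases le_total a b with h | h
  · exact mul_nonneg_of_nonpos_of_nonpos (sub_nonpos.2 (pow_le_pow_left₀ ha.le h x))
      (sub_nonpos.2 (Real.log_le_log ha h))
  · exact mul_nonneg (sub_nonneg.2 (pow_le_pow_left₀ hb.le h x))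
      (sub_nonneg.2 (Real.log_le_log hb h))

/-- The shares are monotone in the logarithms of the coordinates. -/
theorem share_monotone {q r : Fin 3 → ℝ} (hq : ∀ i, 0 < q i) (hr : ∀ i, 0 < r i) (x : ℕ) :
    0 ≤ ∑ i, (share q i x - share r i x) * (Real.log (q i) - Real.log (r i)) := by
  have key (i j : Fin 3) : 0 ≤ coef i x * coef j x *
      ((q i ^ x * r j ^ x - q j ^ x * r i ^ x) *
        ((Real.log (q i) - Real.log (r i)) - (Real.log (q j) - Real.log (r j)))) := by
    refine mul_nonneg (mul_nonneg (coef_nonneg i x) (coef_nonneg j x)) ?_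
    have h := pow_sub_pow_mul_log_sub_log_nonneg (mul_pos (hq i) (hr j))
      (mul_pos (hq j) (hr i)) x
    rw [Real.log_mul (hq i).ne' (hr j).ne', Real.log_mul (hq j).ne' (hr i).ne', mul_pow,
      mul_pow] at h
    exact h.trans_eq (by ring)
  have e : ∑ i, (share q i x - share r i x) * (Real.log (q i) - Real.log (r i)) =
      (∑ i, (coef i x * q i ^ x * denom r x - coef i x * r i ^ x * denom q x) *
        (Real.log (q i) - Real.log (r i))) / (denom q x * denom r x) := by
    rw [Finset.sum_div]
    refine Finset.sum_congr rfl fun i _ => ?_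
    have := (denom_pos hq x).ne'
    have := (denom_pos hr x).ne'
    simp only [share]
    field_simp
  rw [e]
  refine div_nonneg ?_ (mul_pos (denom_pos hq x) (denom_pos hr x)).le
  have h01 := key 0 1
  have h02 := key 0 2
  have h12 := key 1 2
  simp only [denom, Fin.sum_univ_three]
  linear_combination h01 + h02 + h12

theorem mean_monotone {lam : ℝ} (hl : 0 ≤ lam) {q r : Fin 3 → ℝ} (hq : ∀ i, 0 < q i)
    (hr : ∀ i, 0 < r i) :
    0 ≤ ∑ i, (mean lam q i - mean lam r i) * (Real.log (q i) - Real.log (r i)) := by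
  refine HasSum.nonneg (fun x => ?_) (hasSum_sum fun i (_ : i ∈ Finset.univ) =>
    ((hasSum_mean hl hq i).sub (hasSum_mean hl hr i)).mul_right
      (Real.log (q i) - Real.log (r i)))
  convert mul_nonneg (mul_nonneg x.cast_nonneg (poisson_nonneg hl x)) (share_monotone hq hr x)
    using 1
  rw [Finset.mul_sum]
  exact Finset.sum_congr rfl fun i _ => by ring

theorem sub_mul_log_sub_log_pos {a b : ℝ} (ha : 0 < a) (hb : 0 < b) (h : a ≠ b) :
    0 < (a - b) * (Real.log a - Real.log b) := by
  rcases h.lt_or_gt with h | h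
  · exact mul_pos_of_neg_of_neg (sub_neg.2 h) (sub_neg.2 (Real.log_lt_log ha h))
  · exact mul_pos (sub_pos.2 h) (sub_pos.2 (Real.log_lt_log hb h))

theorem eq_of_mean_eq {lam : ℝ} (hl : 0 < lam) {q r : Fin 3 → ℝ} (hq : ∀ i, 0 < q i)
    (hr : ∀ i, 0 < r i) (hmq : ∀ i, mean lam q i = lam * ((1 - q i) / 2))
    (hmr : ∀ i, mean lam r i = lam * ((1 - r i) / 2)) : q = r := by
  by_contra hne
  obtain ⟨i, hi⟩ := Function.ne_iff.1 hne
  have h := mean_monotone hl.le hq hr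
  have hpos : 0 < ∑ i, (q i - r i) * (Real.log (q i) - Real.log (r i)) := by
    refine Finset.sum_pos' (fun j _ => ?_)
      ⟨i, Finset.mem_univ i, sub_mul_log_sub_log_pos (hq i) (hr i) hi⟩
    simpa using pow_sub_pow_mul_log_sub_log_nonneg (hq j) (hr j) 1
  have e : ∑ i, (mean lam q i - mean lam r i) * (Real.log (q i) - Real.log (r i)) =
      -(lam / 2) * ∑ i, (q i - r i) * (Real.log (q i) - Real.log (r i)) := by
    rw [Finset.mul_sum]
    refine Finset.sum_congr rfl fun i _ => ?_
    rw [hmq, hmr]; ring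
  rw [e] at h
  nlinarith [mul_pos hl hpos]

theorem abs_share_third_sub_le (i : Fin 3) (x : ℕ) :
    |share (fun _ => 1 / 3) i x - 1 / 3| ≤ 2 / 3 * (1 / 2) ^ x := by
  rcases x with _ | x
  · have hc : ∑ j, coef j 0 = 1 := by simp [Fin.sum_univ_three, coef]
    simp only [share, denom, pow_zero, mul_one, hc]
    fin_cases i <;> simp [coef, abs_le] <;> norm_num
  · have h1 : (1 : ℝ) ≤ 2 ^ x := one_le_pow₀ (by norm_num)
    have hc0 : coef 0 (x + 1) = 2 * 2 ^ x - 2 := by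
      simp only [coef, Matrix.cons_val_zero, pow_succ]
      rw [max_eq_right] <;> linarith
    have hc1 : coef 1 (x + 1) = 2 * 2 ^ x - 1 := by simp [coef, pow_succ']
    have hc2 : coef 2 (x + 1) = 2 * 2 ^ x := by simp [coef, pow_succ']
    have e : share (fun _ => 1 / 3) i (x + 1) - 1 / 3 =
        ![-1, 0, 1] i / (3 * (2 * 2 ^ x - 1)) := by
      have h2 : (2 : ℝ) * 2 ^ x - 1 ≠ 0 := by linarith
      have h4 : ((1 : ℝ) / 3) ^ (x + 1) ≠ 0 := by positivity
      have h5 : share (fun _ => 1 / 3) i (x + 1) = coef i (x + 1) / ∑ j, coef j (x + 1) := by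
        simp only [share, denom, ← Finset.sum_mul]
        exact mul_div_mul_right _ _ h4
      rw [h5]
      have h6 : (2 : ℝ) * 2 ^ x - 2 + (2 * 2 ^ x - 1) + 2 * 2 ^ x = 3 * (2 * 2 ^ x - 1) := by ring
      rw [Fin.sum_univ_three, hc0, hc1, hc2, h6]
      fin_cases i <;> simp [hc0, hc1, hc2] <;> field_simp <;> ring
    have h6 : |(![-1, 0, 1] i : ℝ)| ≤ 1 := by fin_cases i <;> simp
    rw [e, abs_div, abs_of_pos (by linarith : (0 : ℝ) < 3 * (2 * 2 ^ x - 1)), pow_succ,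
      one_div_pow]
    calc |(![-1, 0, 1] i : ℝ)| / (3 * (2 * 2 ^ x - 1)) ≤ 1 / (3 * 2 ^ x) := by
          gcongr; linarith
      _ = _ := by field_simp

theorem abs_mean_third_sub_le {lam : ℝ} (hl : 4.8 < lam) (i : Fin 3) :
    |mean lam (fun _ => 1 / 3) i - lam / 3| ≤ lam / 30 := by
  have hl0 : 0 ≤ lam := by linarith
  have h1 := (hasSum_mean hl0 (fun _ : Fin 3 => (by norm_num : (0 : ℝ) < 1 / 3)) i).sub
    ((hasSum_mul_poisson lam).mul_right (1 / 3))
  have h2 := (hasSum_mul_poisson_mul_pow lam (1 / 2)).mul_left (2 / 3)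
  have hb (x : ℕ) : |x * poisson lam x * share (fun _ => 1 / 3) i x -
      x * poisson lam x * (1 / 3)| ≤ 2 / 3 * (x * poisson lam x * (1 / 2) ^ x) := by
    have hx := mul_nonneg x.cast_nonneg (poisson_nonneg hl0 x)
    rw [← mul_sub, abs_mul, abs_of_nonneg hx]
    linarith [mul_le_mul_of_nonneg_left (abs_share_third_sub_le i x) hx]
  have h3 : |mean lam (fun _ => 1 / 3) i - lam * (1 / 3)| ≤
      2 / 3 * (lam * (1 / 2) * Real.exp (lam * (1 / 2) - lam)) :=
    abs_le.2 ⟨hasSum_le (fun x => (abs_le.1 (hb x)).1) h2.neg h1,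
      hasSum_le (fun x => (abs_le.1 (hb x)).2) h1 h2⟩
  have h4 : Real.exp (lam * (1 / 2) - lam) ≤ 1 / 10 := by
    have h5 : (10 : ℝ) ≤ Real.exp 2.4 := by
      have e1 := Real.exp_one_gt_d9
      have e2 := Real.add_one_le_exp (0.4 : ℝ)
      have : Real.exp 2.4 = Real.exp 1 * Real.exp 1 * Real.exp 0.4 := by
        rw [← Real.exp_add, ← Real.exp_add]; norm_num
      have e3 : (2.7 : ℝ) * 2.7 ≤ Real.exp 1 * Real.exp 1 := by nlinarith
      rw [this]
      nlinarith
    calc Real.exp (lam * (1 / 2) - lam) ≤ Real.exp (-2.4) := Real.exp_le_exp.2 (by linarith)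
      _ = 1 / Real.exp 2.4 := by rw [Real.exp_neg, one_div]
      _ ≤ 1 / 10 := by gcongr
  have h5 := mul_le_mul_of_nonneg_left h4 hl0
  rw [← mul_one_div lam 3]
  linarith

/-- The potential whose partial derivatives are `(∑ x·p_x·Aᵢ/B − λφᵢ) / q i`. -/
noncomputable def potential (lam : ℝ) (q : Fin 3 → ℝ) : ℝ :=
  ∑' x : ℕ, poisson lam x * Real.log (denom q x) - lam * ∑ i, (Real.log (q i) - q i) / 2

theorem denom_zero (q : Fin 3 → ℝ) : denom q 0 = 1 := by
  simp [denom, coef, Fin.sum_univ_three]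

theorem abs_log_denom_le {q : Fin 3 → ℝ} (hq : ∀ i, q i ∈ Set.Icc (0.2 : ℝ) 0.48) (x : ℕ) :
    |Real.log (denom q x)| ≤ 2 * x := by
  rcases Nat.eq_zero_or_pos x with rfl | hx
  · simp [denom_zero]
  have hx1 : (1 : ℝ) ≤ x := by exact_mod_cast hx
  have hq0 (i : Fin 3) : 0 < q i := lt_of_lt_of_le (by norm_num) (hq i).1
  have hpos := denom_pos hq0 x
  have hterm (i : Fin 3) : coef i x * q i ^ x ≤ 1 := by
    calc coef i x * q i ^ x ≤ 2 ^ x * q i ^ x :=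
          mul_le_mul_of_nonneg_right (coef_le i x) (pow_nonneg (hq0 i).le x)
      _ = (2 * q i) ^ x := (mul_pow _ _ _).symm
      _ ≤ 1 := pow_le_one₀ (by linarith [hq0 i]) (by linarith [(hq i).2])
  have hup : denom q x ≤ 3 := by
    rw [denom, Fin.sum_univ_three]
    linarith [hterm 0, hterm 1, hterm 2]
  have hlow := Real.log_le_log (pow_pos (mul_pos two_pos (hq0 2)) x) (pow_le_denom hq0 x)
  rw [Real.log_pow] at hlow
  have h2 : -2 ≤ Real.log (2 * q 2) := by
    have h := Real.one_sub_inv_le_log_of_pos (mul_pos two_pos (hq0 2))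
    have h3 : (2 * q 2)⁻¹ ≤ 0.4⁻¹ := inv_anti₀ (by norm_num) (by linarith [(hq 2).1])
    have h4 : (0.4 : ℝ)⁻¹ ≤ 3 := by norm_num
    linarith
  have h3 := Real.log_le_sub_one_of_pos hpos
  exact abs_le.2 ⟨by nlinarith, by linarith⟩

theorem continuous_denom (x : ℕ) : Continuous fun q : Fin 3 → ℝ => denom q x := by
  unfold denom; fun_prop

theorem continuousOn_potential {lam : ℝ} (hl : 0 ≤ lam) :
    ContinuousOn (potential lam) (Set.Icc (fun _ => 0.2) (fun _ => 0.48)) := by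
  have hpos {q : Fin 3 → ℝ} (hq : q ∈ Set.Icc (fun _ => (0.2 : ℝ)) (fun _ => 0.48)) (i : Fin 3) :
      0 < q i := lt_of_lt_of_le (by norm_num) (hq.1 i)
  refine ContinuousOn.sub (continuousOn_tsum
    (fun x => continuousOn_const.mul ((continuous_denom x).continuousOn.log
      fun q hq => (denom_pos (hpos hq) x).ne'))
    ((hasSum_mul_poisson lam).mul_left 2).summable fun x q hq => ?_) ?_
  · rw [Real.norm_eq_abs, abs_mul, abs_of_nonneg (poisson_nonneg hl x)]
    linarith [mul_le_mul_of_nonneg_left (abs_log_denom_le (fun i => ⟨hq.1 i, hq.2 i⟩) x)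
      (poisson_nonneg hl x)]
  · refine continuousOn_const.mul (continuousOn_finsetSum _ fun i _ => ?_)
    have hc : ContinuousOn (fun q : Fin 3 → ℝ => q i)
      (Set.Icc (fun _ => 0.2) (fun _ => 0.48)) := (continuous_apply i).continuousOn
    exact ((hc.log fun q hq => (hpos hq i).ne').sub hc).div_const 2

theorem hasDerivAt_apply_update (q : Fin 3 → ℝ) (i j : Fin 3) (s : ℝ) :
    HasDerivAt (fun t => Function.update q i t j) (if j = i then 1 else 0) s := by
  by_cases h : j = i
  · subst h; simpa using hasDerivAt_id' s
  · simpa [h] using hasDerivAt_const s (q j)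

theorem hasDerivAt_denom_update (q : Fin 3 → ℝ) (i : Fin 3) (x : ℕ) (s : ℝ) :
    HasDerivAt (fun t => denom (Function.update q i t) x) (coef i x * (x * s ^ (x - 1))) s := by
  have h := HasDerivAt.fun_sum fun j (_ : j ∈ Finset.univ) =>
    ((hasDerivAt_apply_update q i j s).fun_pow x).const_mul (coef j x)
  exact h.congr_deriv (by simp)

theorem update_pos {q : Fin 3 → ℝ} (hq : ∀ i, 0 < q i) (i : Fin 3) {s : ℝ} (hs : 0 < s)
    (j : Fin 3) : 0 < Function.update q i s j := by
  by_cases h : j = i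
  · subst h; simpa
  · simpa [h] using hq j

theorem hasDerivAt_log_denom_update {q : Fin 3 → ℝ} (hq : ∀ i, 0 < q i) (i : Fin 3) (x : ℕ)
    {s : ℝ} (hs : 0 < s) :
    HasDerivAt (fun t => Real.log (denom (Function.update q i t) x))
      (x * share (Function.update q i s) i x / s) s := by
  have hd := (denom_pos (update_pos hq i hs) x).ne'
  convert (hasDerivAt_denom_update q i x s).log hd using 1
  rcases x with _ | x
  · simp
  · simp only [share, Function.update_self, Nat.add_sub_cancel, pow_succ]
    field_simp

theorem hasDerivAt_potential_update {lam : ℝ} (hl : 0 ≤ lam) {q : Fin 3 → ℝ}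
    (hq : ∀ i, q i ∈ Set.Icc (0.2 : ℝ) 0.48) (i : Fin 3) :
    HasDerivAt (fun t => potential lam (Function.update q i t))
      ((mean lam q i - lam * ((1 - q i) / 2)) / q i) (q i) := by
  have hq0 (i : Fin 3) : 0 < q i := lt_of_lt_of_le (by norm_num) (hq i).1
  have hmem : q i ∈ Set.Ioi (0.1 : ℝ) := lt_of_lt_of_le (by norm_num) (hq i).1
  have hsum : Summable fun x : ℕ =>
      poisson lam x * Real.log (denom (Function.update q i (q i)) x) := by
    rw [Function.update_eq_self]
    refine Summable.of_norm_bounded ((hasSum_mul_poisson lam).mul_left 2).summable fun x => ?_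
    rw [Real.norm_eq_abs, abs_mul, abs_of_nonneg (poisson_nonneg hl x)]
    linarith [mul_le_mul_of_nonneg_left (abs_log_denom_le hq x) (poisson_nonneg hl x)]
  have h1 := hasDerivAt_tsum_of_isPreconnected
    (g := fun (x : ℕ) t => poisson lam x * Real.log (denom (Function.update q i t) x))
    (g' := fun (x : ℕ) s => poisson lam x * (x * share (Function.update q i s) i x / s))
    ((hasSum_mul_poisson lam).mul_left 10).summable isOpen_Ioi isPreconnected_Ioi
    (fun x s hs => (hasDerivAt_log_denom_update hq0 i x
      (lt_trans (by norm_num) (Set.mem_Ioi.1 hs))).const_mul (poisson lam x))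
    (fun x s hs => by
      have hs0 : 0 < s := lt_trans (by norm_num) (Set.mem_Ioi.1 hs)
      have hp := poisson_nonneg hl x
      have hs1 : (0.1 : ℝ) < s := hs
      have h0 := share_nonneg (update_pos hq0 i hs0) i x
      rw [Real.norm_of_nonneg (by positivity)]
      have h2 : x * share (Function.update q i s) i x / s ≤ 10 * x := by
        rw [div_le_iff₀ hs0]
        have h3 := mul_le_mul_of_nonneg_left (share_le_one (update_pos hq0 i hs0) i x) x.cast_nonneg (α := ℝ)
        nlinarith [x.cast_nonneg (α := ℝ)]
      linarith [mul_le_mul_of_nonneg_left h2 hp])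
    hmem hsum hmem
  have h2 : ∑' x : ℕ, poisson lam x * (x * share (Function.update q i (q i)) i x / q i) =
      mean lam q i / q i := by
    rw [mean, ← tsum_div_const, Function.update_eq_self]
    exact tsum_congr fun x => by ring
  rw [h2] at h1
  have h3 := HasDerivAt.fun_sum fun j (_ : j ∈ Finset.univ) =>
    (((hasDerivAt_apply_update q i j (q i)).log (by simpa using (hq0 j).ne')).sub
      (hasDerivAt_apply_update q i j (q i))).div_const 2
  refine (h1.sub (h3.const_mul lam)).congr_deriv ?_
  have h4 : ∀ j, ((if j = i then (1 : ℝ) else 0) / Function.update q i (q i) j -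
      if j = i then 1 else 0) / 2 = if j = i then (1 / q i - 1) / 2 else 0 := by
    intro j
    by_cases h : j = i
    · subst h; simp
    · simp [h]
  have := (hq0 i).ne'
  simp only [h4, Finset.sum_ite_eq', Finset.mem_univ, if_true]
  field_simp

theorem deriv_mul_sub_nonneg_of_isMinOn {f : ℝ → ℝ} {a b s t f' : ℝ}
    (hmin : IsMinOn f (Set.Icc a b) s) (hs : s ∈ Set.Icc a b) (ht : t ∈ Set.Icc a b)
    (hf : HasDerivAt f f' s) : 0 ≤ f' * (t - s) := by
  have h := hmin.localize.hasFDerivWithinAt_nonneg hf.hasFDerivAt.hasFDerivWithinAt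
    (sub_mem_posTangentConeAt_of_segment_subset ((convex_Icc a b).segment_subset hs ht))
  simpa [mul_comm] using h

theorem exists_variational_solution {lam : ℝ} (hl : 0 ≤ lam) :
    ∃ q : Fin 3 → ℝ, (∀ i, q i ∈ Set.Icc (0.2 : ℝ) 0.48) ∧
      ∀ i, ∀ t ∈ Set.Icc (0.2 : ℝ) 0.48,
        0 ≤ (mean lam q i - lam * ((1 - q i) / 2)) * (t - q i) := by
  obtain ⟨q, hqK, hmin⟩ := isCompact_Icc.exists_isMinOn
    (⟨fun _ => 0.2, le_refl _, fun _ => by norm_num⟩ :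
      (Set.Icc (fun _ : Fin 3 => (0.2 : ℝ)) (fun _ => 0.48)).Nonempty)
    (continuousOn_potential hl)
  have hq (i : Fin 3) : q i ∈ Set.Icc (0.2 : ℝ) 0.48 := ⟨hqK.1 i, hqK.2 i⟩
  refine ⟨q, hq, fun i t ht => ?_⟩
  have hmin' : IsMinOn (fun t => potential lam (Function.update q i t))
      (Set.Icc (0.2 : ℝ) 0.48) (q i) := by
    intro s hs
    have : Function.update q i s ∈ Set.Icc (fun _ : Fin 3 => (0.2 : ℝ)) (fun _ => 0.48) :=
      ⟨le_update_iff.2 ⟨hs.1, fun j _ => hqK.1 j⟩, update_le_iff.2 ⟨hs.2, fun j _ => hqK.2 j⟩⟩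
    simpa using hmin this
  have h := deriv_mul_sub_nonneg_of_isMinOn hmin' (hq i) ht (hasDerivAt_potential_update hl hq i)
  have hq0 : 0 < q i := lt_of_lt_of_le (by norm_num) (hq i).1
  have := mul_nonneg h hq0.le
  rwa [mul_right_comm, div_mul_cancel₀ _ hq0.ne'] at this

/-- The excess `(r + (s − 1)/6)·log s` is never far below zero, for small `r`. -/
theorem residual_mul_log_ge {r s : ℝ} (hr : |r| ≤ 1 / 30) (hs : 0 < s) :
    -(1 / 480) ≤ (r + (s - 1) / 6) * Real.log s := by
  obtain ⟨h1, h2⟩ := abs_le.1 hr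
  have hlow := Real.one_sub_inv_le_log_of_pos hs
  have hup := Real.log_le_sub_one_of_pos hs
  rcases le_total 1 s with h | h
  · have hl := Real.log_nonneg h
    have h3 := mul_le_mul_of_nonneg_right
      (show (s - 1) / 6 - 1 / 30 ≤ r + (s - 1) / 6 by linarith) hl
    rcases le_total 1.2 s with h4 | h4
    · nlinarith
    · nlinarith [sq_nonneg (s - 1.1)]
  · have hl := Real.log_nonpos hs.le h
    have h3 := mul_le_mul_of_nonpos_right
      (show r + (s - 1) / 6 ≤ 1 / 30 + (s - 1) / 6 by linarith) hl
    rcases le_total s 0.8 with h4 | h4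
    · nlinarith
    · have h5 : s⁻¹ ≤ 0.8⁻¹ := inv_anti₀ (by norm_num) h4
      have h6 : s * s⁻¹ = 1 := mul_inv_cancel₀ hs.ne'
      have h7 : (1 - s) * s⁻¹ ≤ (1 - s) * 0.8⁻¹ := mul_le_mul_of_nonneg_left h5 (by linarith)
      have h8 : -((1 - s) * 0.8⁻¹) ≤ Real.log s := by linarith
      norm_num at h8
      nlinarith [sq_nonneg (s - 0.9)]

theorem residual_mul_log_gt {r s : ℝ} (hr : |r| ≤ 1 / 30) (hs : s = 0.6 ∨ s = 1.44) :
    2 / 480 < (r + (s - 1) / 6) * Real.log s := by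
  obtain ⟨h1, h2⟩ := abs_le.1 hr
  rcases hs with rfl | rfl
  · have := Real.log_le_sub_one_of_pos (show (0 : ℝ) < 0.6 by norm_num)
    nlinarith
  · have := Real.one_sub_inv_le_log_of_pos (show (0 : ℝ) < 1.44 by norm_num)
    have h3 : (0.3 : ℝ) ≤ 1 - 1.44⁻¹ := by norm_num
    nlinarith

theorem exists_mean_eq {lam : ℝ} (hl : 4.8 < lam) :
    ∃ q : Fin 3 → ℝ, (∀ i, q i ∈ Set.Ioo (0.2 : ℝ) 0.48) ∧
      ∀ i, mean lam q i = lam * ((1 - q i) / 2) := by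
  have hl0 : 0 < lam := by linarith
  obtain ⟨q, hq, hvar⟩ := exists_variational_solution hl0.le
  have hq0 (i : Fin 3) : 0 < q i := lt_of_lt_of_le (by norm_num) (hq i).1
  have hthird : ∀ i : Fin 3, (0 : ℝ) < (fun _ => 1 / 3 : Fin 3 → ℝ) i := fun _ => by norm_num
  have hmono := mean_monotone hl0.le hq0 hthird
  have hvar' (i : Fin 3) : (mean lam q i - lam * ((1 - q i) / 2)) *
      (Real.log (q i) - Real.log (1 / 3)) ≤ 0 := by
    have h := hvar i (1 / 3) (by norm_num)
    rcases lt_trichotomy (q i) (1 / 3) with hc | hc | hc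
    · exact mul_nonpos_of_nonneg_of_nonpos (nonneg_of_mul_nonneg_left h (by linarith))
        (sub_nonpos.2 (Real.log_le_log (hq0 i) hc.le))
    · simp [hc]
    · exact mul_nonpos_of_nonpos_of_nonneg (by nlinarith)
        (sub_nonneg.2 (Real.log_le_log (by norm_num) hc.le))
  set r : Fin 3 → ℝ := fun i => (mean lam (fun _ => 1 / 3) i - lam / 3) / lam with hrdef
  have hr (i : Fin 3) : |r i| ≤ 1 / 30 := by
    rw [hrdef, abs_div, abs_of_pos hl0, div_le_iff₀ hl0]
    linarith [abs_mean_third_sub_le hl i]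
  have hlog (i : Fin 3) : Real.log (q i) - Real.log (1 / 3) = Real.log (3 * q i) := by
    rw [Real.log_mul (by norm_num) (hq0 i).ne', one_div, Real.log_inv]; ring
  have htotal : ∑ i, (r i + (3 * q i - 1) / 6) * Real.log (3 * q i) ≤ 0 := by
    have e : lam * ∑ i, (r i + (3 * q i - 1) / 6) * Real.log (3 * q i) =
        ∑ i, (mean lam q i - lam * ((1 - q i) / 2)) * (Real.log (q i) - Real.log (1 / 3)) -
        ∑ i, (mean lam q i - mean lam (fun _ => 1 / 3) i) *
          (Real.log (q i) - Real.log (1 / 3)) := by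
      rw [← Finset.sum_sub_distrib, Finset.mul_sum]
      refine Finset.sum_congr rfl fun i _ => ?_
      rw [hlog, hrdef]
      field_simp
      ring
    have := Finset.sum_nonpos fun i (_ : i ∈ Finset.univ) => hvar' i
    refine nonpos_of_mul_nonpos_right (a := lam) ?_ hl0
    linarith
  have hs (i : Fin 3) := residual_mul_log_ge (hr i) (mul_pos three_pos (hq0 i))
  have hbd (i : Fin 3) : ¬ (3 * q i = 0.6 ∨ 3 * q i = 1.44) := by
    intro hc
    have h := residual_mul_log_gt (hr i) hc
    rw [Fin.sum_univ_three] at htotal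
    obtain rfl | rfl | rfl : i = 0 ∨ i = 1 ∨ i = 2 := by lia
    · linarith [hs 1, hs 2]
    · linarith [hs 0, hs 2]
    · linarith [hs 0, hs 1]
  have hint (i : Fin 3) : q i ∈ Set.Ioo (0.2 : ℝ) 0.48 :=
    ⟨lt_of_le_of_ne (hq i).1 fun h => hbd i (Or.inl (by rw [← h]; norm_num)),
      lt_of_le_of_ne (hq i).2 fun h => hbd i (Or.inr (by rw [h]; norm_num))⟩
  refine ⟨q, hint, fun i => ?_⟩
  have h1 := hvar i 0.2 (by norm_num)
  have h2 := hvar i 0.48 (by norm_num)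
  have h3 := nonpos_of_mul_nonneg_left h1 (by linarith [(hint i).1])
  have h4 := nonneg_of_mul_nonneg_left h2 (by linarith [(hint i).2])
  linarith

theorem tsum_eq_mean_zero (lam u v w : ℝ) :
    ∑' x : ℕ, (x : ℝ) * poisson lam x * A0 u x / B u v w x =
      mean lam ![1 - 2 * u, 1 - 2 * v, 1 - 2 * w] 0 :=
  tsum_congr fun x => by
    simp [share, denom, coef, A0, A1, A2, B, Fin.sum_univ_three, mul_div_assoc]

theorem tsum_eq_mean_one (lam u v w : ℝ) :
    ∑' x : ℕ, (x : ℝ) * poisson lam x * A1 v x / B u v w x =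
      mean lam ![1 - 2 * u, 1 - 2 * v, 1 - 2 * w] 1 :=
  tsum_congr fun x => by
    simp [share, denom, coef, A0, A1, A2, B, Fin.sum_univ_three, mul_div_assoc]

/-- For `2.4 < c < 2.5` and `λ = 2c`, the system
`λφ0 = Σ_{x=0}^{∞} x p_x A0(x,φ)/B(x,φ)`, `λφ1 = Σ_{x=0}^{∞} x p_x A1(x,φ)/B(x,φ)`
with `φ2 = 1 − φ0 − φ1` has exactly one solution with `0.26 < φ0, φ1, φ2 < 0.4`. -/
theorem stmt10 (c : ℝ) (hc1 : 2.4 < c) (hc2 : c < 2.5) :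
    ∃! phi : ℝ × ℝ,
      (0.26 < phi.1 ∧ phi.1 < 0.4) ∧ (0.26 < phi.2 ∧ phi.2 < 0.4) ∧
      (0.26 < 1 - phi.1 - phi.2 ∧ 1 - phi.1 - phi.2 < 0.4) ∧
      (2 * c) * phi.1 = ∑' x : ℕ, (x : ℝ) * poisson (2 * c) x *
          A0 phi.1 x / B phi.1 phi.2 (1 - phi.1 - phi.2) x ∧
      (2 * c) * phi.2 = ∑' x : ℕ, (x : ℝ) * poisson (2 * c) x *
          A1 phi.2 x / B phi.1 phi.2 (1 - phi.1 - phi.2) x := by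
  have hl : 4.8 < 2 * c := by linarith
  have hl0 : 0 < 2 * c := by linarith
  obtain ⟨q, hq, hmean⟩ := exists_mean_eq hl
  have hq0 (i : Fin 3) : 0 < q i := lt_trans (by norm_num) (hq i).1
  have hsum := sum_mean hl0.le hq0
  rw [Fin.sum_univ_three, hmean, hmean, hmean, ← mul_add, ← mul_add] at hsum
  have hsum' := mul_left_cancel₀ hl0.ne' (hsum.trans (mul_one _).symm)
  have hvec : ![1 - 2 * ((1 - q 0) / 2), 1 - 2 * ((1 - q 1) / 2),
      1 - 2 * (1 - (1 - q 0) / 2 - (1 - q 1) / 2)] = q := by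
    ext i
    fin_cases i <;> simp <;> linarith
  have hb (i : Fin 3) := hq i
  simp only [Set.mem_Ioo] at hb
  refine ⟨((1 - q 0) / 2, (1 - q 1) / 2), ?_, ?_⟩
  · simp only [tsum_eq_mean_zero, tsum_eq_mean_one, hvec, hmean, and_true]
    refine ⟨⟨?_, ?_⟩, ⟨?_, ?_⟩, ?_, ?_⟩ <;> linarith [hb 0, hb 1, hb 2]
  · rintro ⟨u, v⟩ ⟨hu, hv, hw, h0, h1⟩
    simp only [tsum_eq_mean_zero, tsum_eq_mean_one] at hu hv hw h0 h1
    set r : Fin 3 → ℝ := ![1 - 2 * u, 1 - 2 * v, 1 - 2 * (1 - u - v)] with hr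
    have hr0 : ∀ i, 0 < r i := by
      intro i
      fin_cases i <;> simp [hr] <;> linarith
    have hsumr := sum_mean hl0.le hr0
    rw [Fin.sum_univ_three, ← h0, ← h1] at hsumr
    have hmr : ∀ i, mean (2 * c) r i = 2 * c * ((1 - r i) / 2) := by
      intro i
      obtain rfl | rfl | rfl : i = 0 ∨ i = 1 ∨ i = 2 := by lia
      · rw [← h0, show r 0 = 1 - 2 * u from rfl]; ring
      · rw [← h1, show r 1 = 1 - 2 * v from rfl]; ring
      · rw [show r 2 = 1 - 2 * (1 - u - v) from rfl]; linarith
    have heq := eq_of_mean_eq hl0 hr0 hq0 hmr hmean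
    have e0 : 1 - 2 * u = q 0 := congrFun heq 0
    have e1 : 1 - 2 * v = q 1 := congrFun heq 1
    ext <;> simp <;> linarith
end

section
/- Let λ > 0, c = λ/2, X ∈ ℕ, and p_x = p(x,λ). Let I be the finite index set {(0,x,j) : 2 ≤ x ≤ X, 1 ≤ j ≤ x−1} ∪ {(1,x,j) : 1 ≤ x ≤ X, 1 ≤ j ≤ x} ∪ {(2,x,j) : 0 ≤ x ≤ X, 0 ≤ j ≤ x}. For μ : I → ℝ and i ∈ {0,1,2} define φ_i(μ) = λ^(−1)·Σ_{(i,x,j) ∈ I} x·p_x·μ(i,x,j) (the sum over elements of I with first coordinate i), and define f(μ) = Σ_{(i,x,j) ∈ I} p_x·μ(i,x,j)·log( μ(i,x,j) / C(x,j) ) + c·Σ_{i=0}^{2} (1 − 2φ_i(μ))·log(1 − 2φ_i(μ)), with the convention 0·log 0 = 0. Let K be the set of μ : I → ℝ such that μ(i,x,j) ≥ 0 for all (i,x,j) ∈ I, Σ_{(i,j) : (i,x,j) ∈ I} μ(i,x,j) = 1 for every 0 ≤ x ≤ X, and 0.26 < φ_i(μ) < 0.4 for i = 0, 1, 2. Then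 no μ ∈ K having μ(i,x,j) = 0 for some (i,x,j) ∈ I is a local minimum of f restricted to K. -/
open scoped Classical

/-- Membership in the index set `I`:
`(0, x, j)` with `2 ≤ x ≤ X`, `1 ≤ j ≤ x − 1`;
`(1, x, j)` with `1 ≤ x ≤ X`, `1 ≤ j ≤ x`;
`(2, x, j)` with `x ≤ X`, `j ≤ x`. -/
def MemI (X : ℕ) (t : Fin 3 × ℕ × ℕ) : Prop :=
  (t.1 = 0 ∧ 2 ≤ t.2.1 ∧ t.2.1 ≤ X ∧ 1 ≤ t.2.2 ∧ t.2.2 ≤ t.2.1 - 1) ∨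
  (t.1 = 1 ∧ 1 ≤ t.2.1 ∧ t.2.1 ≤ X ∧ 1 ≤ t.2.2 ∧ t.2.2 ≤ t.2.1) ∨
  (t.1 = 2 ∧ t.2.1 ≤ X ∧ t.2.2 ≤ t.2.1)

/-- The index set `I` as a type. -/
def Idx (X : ℕ) := {t : Fin 3 × ℕ × ℕ // MemI X t}

/-- `φ_i(μ) = λ⁻¹ Σ_{(i,x,j) ∈ I} x p_x μ(i,x,j)`. -/
noncomputable def phiOf (lam : ℝ) (X : ℕ) (μ : Idx X → ℝ) (i : Fin 3) : ℝ :=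
  lam⁻¹ * ∑ x ∈ Finset.range (X + 1), ∑ j ∈ Finset.range (x + 1),
    if h : MemI X (i, x, j) then (x : ℝ) * poisson lam x * μ ⟨(i, x, j), h⟩ else 0

/-- The objective function
`f(μ) = Σ_{(i,x,j) ∈ I} p_x μ(i,x,j) log(μ(i,x,j)/C(x,j))
  + c Σ_i (1 − 2φ_i(μ)) log(1 − 2φ_i(μ))` with `c = λ/2`
(the convention `0 log 0 = 0` holds automatically since `Real.log 0 = 0`). -/
noncomputable def fObj (lam : ℝ) (X : ℕ) (μ : Idx X → ℝ) : ℝ :=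
  (∑ x ∈ Finset.range (X + 1), ∑ j ∈ Finset.range (x + 1), ∑ i : Fin 3,
    if h : MemI X (i, x, j) then
      poisson lam x * μ ⟨(i, x, j), h⟩ *
        Real.log (μ ⟨(i, x, j), h⟩ / (Nat.choose x j : ℝ))
    else 0) +
  (lam / 2) * ∑ i : Fin 3,
    (1 - 2 * phiOf lam X μ i) * Real.log (1 - 2 * phiOf lam X μ i)

/-- The constraint set `K`: nonnegative `μ`, normalisation `Σ_{(i,j)} μ(i,x,j) = 1`
for every `x ≤ X`, and `0.26 < φ_i(μ) < 0.4` for each `i`. -/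
def KSet (lam : ℝ) (X : ℕ) : Set (Idx X → ℝ) :=
  {μ | (∀ t, 0 ≤ μ t) ∧
    (∀ x ≤ X, (∑ i : Fin 3, ∑ j ∈ Finset.range (x + 1),
      if h : MemI X (i, x, j) then μ ⟨(i, x, j), h⟩ else 0) = 1) ∧
    (∀ i, 0.26 < phiOf lam X μ i ∧ phiOf lam X μ i < 0.4)}

theorem poisson_pos {lam : ℝ} (hlam : 0 < lam) (x : ℕ) : 0 < poisson lam x := by
  unfold poisson
  positivity

/-- The indicator of a single index, as a function on the index set. -/
noncomputable def idxIndicator {X : ℕ} (t : Idx X) (u : Idx X) : ℝ := if u = t then 1 else 0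

theorem MemI.snd_le {X : ℕ} {t : Fin 3 × ℕ × ℕ} (h : MemI X t) :
    t.2.1 ≤ X ∧ t.2.2 ≤ t.2.1 := by
  unfold MemI at h
  omega

/-- The row sums of the indicator of `t`. -/
theorem sum_idxIndicator {X : ℕ} (t : Idx X) (x : ℕ) :
    (∑ i : Fin 3, ∑ j ∈ Finset.range (x + 1),
      if h : MemI X (i, x, j) then idxIndicator t ⟨(i, x, j), h⟩ else 0)
      = if x = t.1.2.1 then 1 else 0 := by
  obtain ⟨⟨i₀, x₀, j₀⟩, ht⟩ := t
  have hle := ht.snd_le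
  have key : ∀ (i : Fin 3) (j : ℕ),
      (if h : MemI X (i, x, j) then
        idxIndicator (⟨(i₀, x₀, j₀), ht⟩ : Idx X) ⟨(i, x, j), h⟩ else 0)
      = if i = i₀ then (if j = j₀ then (if x = x₀ then (1 : ℝ) else 0) else 0) else 0 := by
    intro i j
    by_cases hi : i = i₀
    · by_cases hj : j = j₀
      · by_cases hx : x = x₀
        · subst hi hj hx
          rw [dif_pos ht]
          simp only [if_true]
          exact if_pos rfl
        · simp [idxIndicator, Idx, hx]
      · simp [idxIndicator, Idx, hj]
    · simp [idxIndicator, Idx, hi]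
  simp only [key]
  rw [Finset.sum_eq_single i₀ (by intro b _ hb; simp [hb]) (by simp)]
  simp only [if_true, Finset.sum_ite_eq', Finset.mem_range]
  by_cases hx : x = x₀
  · subst hx
    simp only at hle
    simp [Nat.lt_succ_of_le hle.2]
  · simp [hx]

/-- A function of the form `G ε + B * (ε * log ε)` with `B > 0` and `G` differentiable at `0`
takes values below `G 0` arbitrarily close to the right of `0`. -/
theorem not_eventually_le_of_differentiableAt_add_mul_log {G : ℝ → ℝ} {B : ℝ} (hB : 0 < B)
    (hG : DifferentiableAt ℝ G 0) :
    ¬ ∀ᶠ ε in nhdsWithin (0 : ℝ) (Set.Ioi 0), G 0 ≤ G ε + B * (ε * Real.log ε) := by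
  intro hle
  have hslope : Filter.Tendsto (slope G 0) (nhdsWithin 0 (Set.Ioi 0)) (nhds (deriv G 0)) :=
    (hasDerivAt_iff_tendsto_slope.1 hG.hasDerivAt).mono_left
      (nhdsWithin_mono _ fun y hy => ne_of_gt hy)
  have hlog : Filter.Tendsto (fun ε => B * Real.log ε) (nhdsWithin 0 (Set.Ioi 0))
      Filter.atBot := Real.tendsto_log_nhdsGT_zero.const_mul_atBot hB
  have hsum := hlog.atBot_add hslope
  obtain ⟨ε, ⟨hε, hneg⟩, hpos⟩ :=
    ((hle.and (hsum.eventually (Filter.eventually_lt_atBot 0))).and self_mem_nhdsWithin).exists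
  have hpos' : (0 : ℝ) < ε := hpos
  rw [slope_def_field, sub_zero] at hneg
  have := mul_neg_of_pos_of_neg hpos' hneg
  have h2 : ε * (B * Real.log ε + (G ε - G 0) / ε) = B * (ε * Real.log ε) + (G ε - G 0) := by
    field_simp
  linarith

theorem differentiableAt_phiOf_line (lam : ℝ) (X : ℕ) (μ d : Idx X → ℝ) (i : Fin 3) :
    DifferentiableAt ℝ (fun ε : ℝ => phiOf lam X (μ + ε • d) i) 0 := by
  unfold phiOf
  refine DifferentiableAt.const_mul (DifferentiableAt.fun_sum fun x _ =>
    DifferentiableAt.fun_sum fun j _ => ?_) _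
  by_cases h : MemI X (i, x, j)
  · simp only [h, dif_pos]
    have hline (u : Idx X) : DifferentiableAt ℝ
        (fun ε : ℝ => (x : ℝ) * poisson lam x * (μ + ε • d) u) 0 := by
      simp only [Pi.add_apply, Pi.smul_apply, smul_eq_mul]
      fun_prop
    exact hline _
  · simp only [h, dif_neg, not_false_eq_true]
    fun_prop

/-- Moving mass from an index `s` of positive mass to an index `t` of zero mass, the entropy
term at `u` is differentiable up to a multiple of `ε * log ε`, present only for `u = t`. -/
theorem differentiableAt_entropy_line {X : ℕ} {μ : Idx X → ℝ} {s t : Idx X}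
    (ht : μ t = 0) (hs : μ s ≠ 0) (p : ℝ) {C : ℝ} (hC : C ≠ 0) (u : Idx X) :
    DifferentiableAt ℝ (fun ε : ℝ =>
      p * (μ + ε • (idxIndicator t - idxIndicator s)) u *
        Real.log ((μ + ε • (idxIndicator t - idxIndicator s)) u / C)
      - p * idxIndicator t u * (ε * Real.log ε)) 0 := by
  have hst : s ≠ t := by
    rintro rfl
    exact hs ht
  by_cases hut : u = t
  · subst hut
    have : (fun ε : ℝ =>
        p * (μ + ε • (idxIndicator u - idxIndicator s)) u *
          Real.log ((μ + ε • (idxIndicator u - idxIndicator s)) u / C)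
        - p * idxIndicator u u * (ε * Real.log ε)) = fun ε => -(p * Real.log C) * ε := by
      funext ε
      rcases eq_or_ne ε 0 with rfl | hε
      · simp [ht]
      · simp only [Pi.add_apply, Pi.smul_apply, Pi.sub_apply, idxIndicator, ht, hst.symm,
          if_true, if_false, smul_eq_mul, sub_zero, mul_one, zero_add, Real.log_div hε hC]
        ring
    rw [this]
    fun_prop
  · by_cases hus : u = s
    · subst hus
      simp only [Pi.add_apply, Pi.smul_apply, Pi.sub_apply, idxIndicator, hut, if_true, if_false,
        smul_eq_mul, mul_zero, zero_mul, sub_zero, zero_sub, mul_neg, mul_one]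
      have : (μ u + -0) / C ≠ 0 := by simp [hs, hC]
      fun_prop (disch := assumption)
    · simp only [Pi.add_apply, Pi.smul_apply, Pi.sub_apply, idxIndicator, hut, hus, if_false,
        smul_eq_mul, mul_zero, zero_mul, sub_zero, add_zero]
      fun_prop

/-- The total coefficient of `ε * log ε` in the objective along a line entering index `t`. -/
noncomputable def logCoeff (lam : ℝ) (X : ℕ) (t : Idx X) : ℝ :=
  ∑ x ∈ Finset.range (X + 1), ∑ j ∈ Finset.range (x + 1), ∑ i : Fin 3,
    if h : MemI X (i, x, j) then poisson lam x * idxIndicator t ⟨(i, x, j), h⟩ else 0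

theorem logCoeff_pos {lam : ℝ} (hlam : 0 < lam) {X : ℕ} (t : Idx X) :
    0 < logCoeff lam X t := by
  have hnn : ∀ (i : Fin 3) (x j : ℕ), 0 ≤
      if h : MemI X (i, x, j) then poisson lam x * idxIndicator t ⟨(i, x, j), h⟩ else 0 := by
    intro i x j
    split_ifs
    · unfold idxIndicator
      have := (poisson_pos hlam x).le
      split_ifs <;> simp [this]
    · rfl
  obtain ⟨⟨i₀, x₀, j₀⟩, ht⟩ := t
  have hle := ht.snd_le
  simp only at hle
  unfold logCoeff
  refine Finset.sum_pos' (fun x _ => Finset.sum_nonneg fun j _ => Finset.sum_nonneg fun i _ =>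
    hnn i x j) ⟨x₀, Finset.mem_range.2 (by omega), ?_⟩
  refine Finset.sum_pos' (fun j _ => Finset.sum_nonneg fun i _ => hnn i x₀ j)
    ⟨j₀, Finset.mem_range.2 (by omega), ?_⟩
  refine Finset.sum_pos' (fun i _ => hnn i x₀ j₀) ⟨i₀, Finset.mem_univ _, ?_⟩
  rw [dif_pos ht]
  exact mul_pos (poisson_pos hlam x₀) (one_pos.trans_eq (if_pos rfl).symm)

theorem differentiableAt_fObj_line {lam : ℝ} {X : ℕ} {μ : Idx X → ℝ}
    (hμ : μ ∈ KSet lam X) {s t : Idx X} (ht : μ t = 0) (hs : μ s ≠ 0) :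
    DifferentiableAt ℝ (fun ε : ℝ =>
      fObj lam X (μ + ε • (idxIndicator t - idxIndicator s))
        - logCoeff lam X t * (ε * Real.log ε)) 0 := by
  unfold fObj logCoeff
  simp only [add_sub_right_comm, Finset.sum_mul, ← Finset.sum_sub_distrib]
  refine DifferentiableAt.fun_add (DifferentiableAt.fun_sum fun x _ =>
    DifferentiableAt.fun_sum fun j _ => DifferentiableAt.fun_sum fun i _ => ?_)
    (DifferentiableAt.const_mul (DifferentiableAt.fun_sum fun i _ => ?_) _)
  · by_cases h : MemI X (i, x, j)
    · simp only [h, dif_pos]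
      have hC : ((x.choose j : ℕ) : ℝ) ≠ 0 :=
        Nat.cast_ne_zero.2 (Nat.choose_pos h.snd_le.2).ne'
      exact differentiableAt_entropy_line ht hs _ hC _
    · simp [h]
  · have hphi := differentiableAt_phiOf_line lam X μ (idxIndicator t - idxIndicator s) i
    have hlin := (hphi.const_mul 2).const_sub 1
    refine hlin.fun_mul (hlin.log ?_)
    have := (hμ.2.2 i).2
    simp only [zero_smul, add_zero]
    norm_num at this ⊢
    linarith

theorem eventually_line_mem_KSet {lam : ℝ} {X : ℕ} {μ : Idx X → ℝ}
    (hμ : μ ∈ KSet lam X) {s t : Idx X} (hs : 0 < μ s) (hx : s.1.2.1 = t.1.2.1) :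
    ∀ᶠ ε in nhdsWithin (0 : ℝ) (Set.Ioi 0),
      μ + ε • (idxIndicator t - idxIndicator s) ∈ KSet lam X := by
  have hphi : ∀ᶠ ε in nhds (0 : ℝ), ∀ i,
      0.26 < phiOf lam X (μ + ε • (idxIndicator t - idxIndicator s)) i ∧
        phiOf lam X (μ + ε • (idxIndicator t - idxIndicator s)) i < 0.4 := by
    refine Filter.eventually_all.2 fun i => ?_
    have hc := (differentiableAt_phiOf_line lam X μ (idxIndicator t - idxIndicator s) i).continuousAt
    refine hc.eventually_mem (Ioo_mem_nhds ?_ ?_) <;> simp only [zero_smul, add_zero]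
    exacts [(hμ.2.2 i).1, (hμ.2.2 i).2]
  filter_upwards [nhdsWithin_le_nhds hphi, self_mem_nhdsWithin,
    nhdsWithin_le_nhds (Iio_mem_nhds hs)] with ε hε hpos hlt
  have hpos' : (0 : ℝ) < ε := hpos
  have hlt' : ε < μ s := hlt
  refine ⟨fun u => ?_, fun x hxX => ?_, hε⟩
  · have hu := hμ.1 u
    simp only [Pi.add_apply, Pi.smul_apply, Pi.sub_apply, smul_eq_mul, idxIndicator]
    by_cases hus : u = s
    · subst hus
      split_ifs <;> linarith
    · simp only [hus, if_false]
      split_ifs <;> linarith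
  · have hrow := hμ.2.1 x hxX
    have h1 := sum_idxIndicator t x
    have h2 := sum_idxIndicator s x
    rw [hx, ← h1] at h2
    have hsplit : ∀ (i : Fin 3) (j : ℕ),
        (if h : MemI X (i, x, j) then
          (μ + ε • (idxIndicator t - idxIndicator s)) ⟨(i, x, j), h⟩ else 0)
        = (if h : MemI X (i, x, j) then μ ⟨(i, x, j), h⟩ else 0)
          + ε * ((if h : MemI X (i, x, j) then idxIndicator t ⟨(i, x, j), h⟩ else 0)
            - (if h : MemI X (i, x, j) then idxIndicator s ⟨(i, x, j), h⟩ else 0)) := by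
      intro i j
      by_cases h : MemI X (i, x, j)
      · simp only [dif_pos h]
        rfl
      · simp [h]
    simp only [hsplit, Finset.sum_add_distrib, ← Finset.mul_sum, Finset.sum_sub_distrib]
    rw [hrow, h2]
    ring

/-- Every row of a point of `K` carries positive mass somewhere. -/
theorem exists_pos_of_mem_KSet {lam : ℝ} {X : ℕ} {μ : Idx X → ℝ} (hμ : μ ∈ KSet lam X)
    {x : ℕ} (hx : x ≤ X) : ∃ s : Idx X, s.1.2.1 = x ∧ 0 < μ s := by
  have hrow : (∑ i : Fin 3, ∑ j ∈ Finset.range (x + 1),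
      if h : MemI X (i, x, j) then μ ⟨(i, x, j), h⟩ else 0) ≠ 0 := by
    rw [hμ.2.1 x hx]
    exact one_ne_zero
  obtain ⟨i, -, hi⟩ := Finset.exists_ne_zero_of_sum_ne_zero hrow
  obtain ⟨j, -, hj⟩ := Finset.exists_ne_zero_of_sum_ne_zero hi
  by_cases h : MemI X (i, x, j)
  · rw [dif_pos h] at hj
    exact ⟨⟨(i, x, j), h⟩, rfl, lt_of_le_of_ne (hμ.1 _) hj.symm⟩
  · exact absurd (dif_neg h) hj

/-- No `μ ∈ K` having a zero coordinate is a local minimum of `f` on `K`. -/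
theorem stmt14 (lam : ℝ) (hlam : 0 < lam) (X : ℕ) (μ : Idx X → ℝ)
    (hμ : μ ∈ KSet lam X) (h0 : ∃ t, μ t = 0) :
    ¬ IsLocalMinOn (fObj lam X) (KSet lam X) μ := by
  obtain ⟨t, ht⟩ := h0
  obtain ⟨s, hx, hs⟩ := exists_pos_of_mem_KSet hμ t.2.snd_le.1
  intro hmin
  have hline : Filter.Tendsto (fun ε : ℝ => μ + ε • (idxIndicator t - idxIndicator s))
      (nhdsWithin 0 (Set.Ioi 0)) (nhdsWithin μ (KSet lam X)) := by
    refine tendsto_nhdsWithin_iff.2 ⟨?_, eventually_line_mem_KSet hμ hs hx⟩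
    have hc : Continuous fun ε : ℝ => μ + ε • (idxIndicator t - idxIndicator s) := by fun_prop
    simpa using (hc.tendsto 0).mono_left nhdsWithin_le_nhds
  refine not_eventually_le_of_differentiableAt_add_mul_log (logCoeff_pos hlam t)
    (differentiableAt_fObj_line hμ ht hs.ne') ?_
  filter_upwards [hline.eventually hmin] with ε hε
  simpa using hε
end
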